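/- Assume gcd(s+l,2l) = gcd(s,l) = d and d is odd. Then the number of quadruples (a,b,c,h) ∈ F_{p^s} × F_q × F_q × F_p for which the codeword c(a,b,c,h) has Hamming weight (p−1)(p^{m−1} + p^{s−1}) equals p^{m+d}(p^m − 2p^{m−d} + 1)(p^s − 1)/(2(p^d − 1)). -/

import Mathlib

/-- `trp p r z = z + z^p + ⋯ + z^(p^(r-1))`, the trace form used for `Tr_r`. -/
def trp (p r : ℕ) {F : Type} [Field F] (z : F) : F :=
  ∑ i ∈ Finset.range r, z ^ p ^ i

/-- The codeword `c(a,b,c,h)` of the code `C`, viewed as a function on `F_q = F`;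
its value at `x` is `Tr_s(a x^(p^s+1)) + Tr_m(b x^(p^l+1) + c x) + h` (the values
lie in the prime field `F_p ⊆ F`). Here `m = 2s`. -/
def cword (p s l : ℕ) {F : Type} [Field F] (a b c : F) (h : ZMod p) : F → F :=
  fun x => trp p s (a * x ^ (p ^ s + 1)) + trp p (2 * s) (b * x ^ (p ^ l + 1) + c * x)
    + ZMod.cast h

/-- The support of the codeword `c(a,b,c,h)`; its cardinality is the Hamming weight. -/
def suppw (p s l : ℕ) {F : Type} [Field F] [Fintype F] [DecidableEq F]
    (a b c : F) (h : ZMod p) : Finset F :=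
  Finset.univ.filter fun x => cword p s l a b c h x ≠ 0

open Finset

/-- The quadratic character of `ZMod p` with values in `ℂ`. -/
noncomputable def qchar (p : ℕ) [Fact p.Prime] : MulChar (ZMod p) ℂ :=
  (quadraticChar (ZMod p)).ringHomComp (Int.castRingHom ℂ)

/-- The quadratic Gauss sum over `ZMod p`. -/
noncomputable def qgauss (p : ℕ) [Fact p.Prime] : ℂ :=
  gaussSum (qchar p) ZMod.stdAddChar

section GaussSums

variable {p : ℕ} [Fact p.Prime]

theorem ringChar_zmod_ne_two (hp : p ≠ 2) : ringChar (ZMod p) ≠ 2 := by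
  rwa [ZMod.ringChar_zmod_n]

theorem two_ne_zero_zmod (hp : p ≠ 2) : (2 : ZMod p) ≠ 0 :=
  Ring.two_ne_zero (ringChar_zmod_ne_two hp)

theorem qchar_eq_one_or_neg_one {y : ZMod p} (hy : y ≠ 0) : qchar p y = 1 ∨ qchar p y = -1 := by
  rcases quadraticChar_dichotomy hy with h | h <;> simp [qchar, h]

theorem qchar_ne_one (hp : p ≠ 2) : qchar p ≠ 1 :=
  (MulChar.ringHomComp_ne_one_iff (RingHom.injective_int _)).mpr
    (quadraticChar_ne_one (ringChar_zmod_ne_two hp))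

theorem qgauss_sq (hp : p ≠ 2) : qgauss p ^ 2 = qchar p (-1) * p := by
  have := gaussSum_sq (qchar_ne_one hp) ((quadraticChar_isQuadratic (ZMod p)).comp _)
    (ZMod.isPrimitive_stdAddChar p)
  rw [ZMod.card] at this
  exact this

theorem sum_qchar_mul_stdAddChar (hp : p ≠ 2) (t : ZMod p) :
    ∑ y, qchar p y * ZMod.stdAddChar (t * y) = qchar p t * qgauss p := by
  have h := gaussSum_mulShift_eq (qchar p) ZMod.stdAddChar
  by_cases ht : t = 0
  · subst ht
    simp only [zero_mul, AddChar.map_zero_eq_one, mul_one]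
    rw [MulChar.sum_eq_zero_of_ne_one (qchar_ne_one hp), MulChar.map_zero, zero_mul]
  · have h1 := gaussSum_mulShift (qchar p) ZMod.stdAddChar (Units.mk0 t ht)
    have h2 : qchar p t * qchar p t = 1 := by
      rcases qchar_eq_one_or_neg_one ht with h | h <;> simp [h]
    simp only [gaussSum, Units.val_mk0, AddChar.mulShift_apply] at h1
    rw [qgauss, gaussSum, ← h1, ← mul_assoc, h2, one_mul]

theorem sum_stdAddChar_mul (t : ZMod p) :
    ∑ y : ZMod p, (ZMod.stdAddChar (y * t) : ℂ) = if t = 0 then (p : ℂ) else 0 := by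
  rw [AddChar.sum_mulShift t (ZMod.isPrimitive_stdAddChar p), ZMod.card]
  simp

theorem sum_stdAddChar_sq (hp : p ≠ 2) {w : ZMod p} (hw : w ≠ 0) :
    ∑ x, (ZMod.stdAddChar (w * x ^ 2) : ℂ) = qchar p w * qgauss p := by
  classical
  have h1 : ∑ x, (ZMod.stdAddChar (w * x ^ 2) : ℂ)
      = ∑ t, (1 + qchar p t) * ZMod.stdAddChar (w * t) := by
    rw [← Finset.sum_fiberwise univ (fun x : ZMod p => x ^ 2)]
    refine Finset.sum_congr rfl fun t _ => ?_
    have h2 := quadraticChar_card_sqrts (ringChar_zmod_ne_two hp) t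
    have h3 : ((univ.filter fun x : ZMod p => x ^ 2 = t).card : ℂ) = 1 + qchar p t := by
      have h4 : {x : ZMod p | x ^ 2 = t}.toFinset = univ.filter fun x : ZMod p => x ^ 2 = t := by
        ext; simp
      rw [h4] at h2
      have h5 : (((univ.filter fun x : ZMod p => x ^ 2 = t).card : ℤ) : ℂ)
          = ((quadraticChar (ZMod p) t + 1 : ℤ) : ℂ) := congrArg _ h2
      push_cast at h5
      rw [h5, qchar, MulChar.ringHomComp_apply, add_comm]
      simp
    rw [← h3, Finset.sum_congr rfl (g := fun _ => (ZMod.stdAddChar (w * t) : ℂ)),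
      Finset.sum_const, nsmul_eq_mul]
    intro x hx
    rw [(Finset.mem_filter.mp hx).2]
  rw [h1]
  simp only [add_mul, one_mul, Finset.sum_add_distrib]
  rw [sum_qchar_mul_stdAddChar hp]
  have h2 := sum_stdAddChar_mul w
  rw [if_neg hw] at h2
  simp only [mul_comm w] at *
  rw [h2, zero_add]

theorem sum_stdAddChar_quadratic (hp : p ≠ 2) {w : ZMod p} (hw : w ≠ 0) (c : ZMod p) :
    ∑ x, (ZMod.stdAddChar (w * x ^ 2 + c * x) : ℂ)
      = qchar p w * qgauss p * ZMod.stdAddChar (-(c ^ 2 / (4 * w))) := by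
  have h2 := two_ne_zero_zmod hp
  have h4 : (4 : ZMod p) ≠ 0 := by
    have : (4 : ZMod p) = 2 * 2 := by norm_num
    rw [this]; exact mul_ne_zero h2 h2
  rw [← sum_stdAddChar_sq hp hw, Finset.sum_mul]
  refine Eq.symm ((Equiv.sum_comp (Equiv.addRight (c / (2 * w))) _).symm.trans ?_)
  refine Finset.sum_congr rfl fun x _ => ?_
  rw [← AddChar.map_add_eq_mul, Equiv.coe_addRight]
  congr 1
  field_simp
  ring

end GaussSums

section QuadraticForms

variable {p : ℕ} [Fact p.Prime]

theorem stdAddChar_sum {ι : Type*} (s : Finset ι) (f : ι → ZMod p) :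
    (ZMod.stdAddChar (∑ i ∈ s, f i) : ℂ) = ∏ i ∈ s, ZMod.stdAddChar (f i) := by
  classical
  induction s using Finset.induction_on with
  | empty => simp
  | insert a s ha ih => rw [Finset.sum_insert ha, Finset.prod_insert ha, AddChar.map_add_eq_mul, ih]

theorem sum_stdAddChar_diagonal {n : ℕ} (w c : Fin n → ZMod p) :
    ∑ x : Fin n → ZMod p, (ZMod.stdAddChar (∑ i, (w i * x i ^ 2 + c i * x i)) : ℂ)
      = ∏ i, ∑ t, (ZMod.stdAddChar (w i * t ^ 2 + c i * t) : ℂ) := by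
  classical
  rw [Finset.prod_univ_sum, Fintype.piFinset_univ]
  refine Finset.sum_congr rfl fun x _ => ?_
  rw [stdAddChar_sum]

/-- Evaluation of the exponential sums attached to a diagonal quadratic form twisted by a
linear form. -/
theorem sum_stdAddChar_diagonal_eval (hp : p ≠ 2) {n : ℕ} (w c : Fin n → ZMod p)
    (hc : ∀ i, w i = 0 → c i = 0) (y : ZMod p) (hy : y ≠ 0) :
    ∑ x : Fin n → ZMod p, (ZMod.stdAddChar (y * ∑ i, (w i * x i ^ 2 + c i * x i)) : ℂ)
      = (p : ℂ) ^ (n - (univ.filter fun i => w i ≠ 0).card)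
        * qchar p y ^ (univ.filter fun i => w i ≠ 0).card
        * (∏ i ∈ univ.filter fun i => w i ≠ 0, qchar p (w i))
        * qgauss p ^ (univ.filter fun i => w i ≠ 0).card
        * ZMod.stdAddChar (-(y * ∑ i ∈ univ.filter fun i => w i ≠ 0, c i ^ 2 / (4 * w i))) := by
  classical
  have h2 := two_ne_zero_zmod hp
  have h1 : ∀ x : Fin n → ZMod p, y * ∑ i, (w i * x i ^ 2 + c i * x i)
      = ∑ i, ((y * w i) * x i ^ 2 + (y * c i) * x i) := by
    intro x
    rw [Finset.mul_sum]
    exact Finset.sum_congr rfl fun i _ => by ring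
  simp only [h1]
  rw [sum_stdAddChar_diagonal (fun i => y * w i) (fun i => y * c i),
    ← Finset.prod_filter_mul_prod_filter_not univ (fun i => w i ≠ 0)]
  have h3 : ∀ i ∈ univ.filter (fun i => w i ≠ 0),
      ∑ t, (ZMod.stdAddChar ((y * w i) * t ^ 2 + (y * c i) * t) : ℂ)
      = qchar p y * qchar p (w i) * qgauss p *
        ZMod.stdAddChar (-(y * (c i ^ 2 / (4 * w i)))) := by
    intro i hi
    have hw := (Finset.mem_filter.mp hi).2
    rw [sum_stdAddChar_quadratic hp (mul_ne_zero hy hw), map_mul]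
    congr 3
    field_simp
  have h4 : ∀ i ∈ univ.filter (fun i => ¬ w i ≠ 0),
      ∑ t, (ZMod.stdAddChar ((y * w i) * t ^ 2 + (y * c i) * t) : ℂ) = p := by
    intro i hi
    have hw := not_not.mp (Finset.mem_filter.mp hi).2
    simp [hw, hc i hw, ZMod.card]
  rw [Finset.prod_congr rfl h3, Finset.prod_congr rfl h4]
  simp only [Finset.prod_mul_distrib, Finset.prod_const]
  have h5 : (univ.filter fun i => ¬ w i ≠ 0).card = n - (univ.filter fun i => w i ≠ 0).card := by
    have := Finset.card_filter_add_card_filter_not (s := (univ : Finset (Fin n))) (fun i => w i ≠ 0)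
    rw [Finset.card_univ, Fintype.card_fin] at this
    omega
  rw [h5, Finset.mul_sum, ← Finset.sum_neg_distrib, stdAddChar_sum]
  ring

theorem sum_stdAddChar_diagonal_eq_zero {n : ℕ} (w c : Fin n → ZMod p)
    {i : Fin n} (hw : w i = 0) (hc : c i ≠ 0) {y : ZMod p} (hy : y ≠ 0) :
    ∑ x : Fin n → ZMod p, (ZMod.stdAddChar (y * ∑ i, (w i * x i ^ 2 + c i * x i)) : ℂ) = 0 := by
  have h1 : ∀ x : Fin n → ZMod p, y * ∑ i, (w i * x i ^ 2 + c i * x i)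
      = ∑ i, ((y * w i) * x i ^ 2 + (y * c i) * x i) := by
    intro x
    rw [Finset.mul_sum]
    exact Finset.sum_congr rfl fun i _ => by ring
  simp only [h1]
  rw [sum_stdAddChar_diagonal (fun i => y * w i) (fun i => y * c i)]
  refine Finset.prod_eq_zero (Finset.mem_univ i) ?_
  have := sum_stdAddChar_mul (y * c i)
  rw [if_neg (mul_ne_zero hy hc)] at this
  rw [← this]
  refine Finset.sum_congr rfl fun t _ => ?_
  rw [hw]
  congr 1
  ring

/-- Evaluation of the exponential sums attached to a quadratic form over `ZMod p`, twisted by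
a linear form. -/
theorem QuadraticForm.exists_sum_stdAddChar_eval (hp : p ≠ 2) {V : Type*} [AddCommGroup V]
    [Module (ZMod p) V] [Fintype V] (Q : QuadraticForm (ZMod p) V) :
    ∃ r ≤ Module.finrank (ZMod p) V, ∃ ε : ℂ, (ε = 1 ∨ ε = -1) ∧
      (∀ y : ZMod p, y ≠ 0 → ∑ x, (ZMod.stdAddChar (y * Q x) : ℂ)
        = (p : ℂ) ^ (Module.finrank (ZMod p) V - r) * qchar p y ^ r * ε * qgauss p ^ r) ∧
      ∀ ℓ : V →ₗ[ZMod p] ZMod p,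
        (r ≠ Module.finrank (ZMod p) V ∧
          ∀ y : ZMod p, y ≠ 0 → ∑ x, (ZMod.stdAddChar (y * (Q x + ℓ x)) : ℂ) = 0) ∨
        ∃ κ : ZMod p, ∀ y : ZMod p, y ≠ 0 → ∑ x, (ZMod.stdAddChar (y * (Q x + ℓ x)) : ℂ)
          = (p : ℂ) ^ (Module.finrank (ZMod p) V - r) * qchar p y ^ r * ε * qgauss p ^ r
            * ZMod.stdAddChar (-(y * κ)) := by
  classical
  have : Invertible (2 : ZMod p) := invertibleOfNonzero (two_ne_zero_zmod hp)
  obtain ⟨w, ⟨e⟩⟩ := Q.equivalent_weightedSumSquares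
  have key : ∀ (ℓ : V →ₗ[ZMod p] ZMod p) (y : ZMod p),
      ∑ x, (ZMod.stdAddChar (y * (Q x + ℓ x)) : ℂ) =
      ∑ x : Fin (Module.finrank (ZMod p) V) → ZMod p, (ZMod.stdAddChar
        (y * ∑ i, (w i * x i ^ 2 + ℓ (e.symm (Pi.single i 1)) * x i)) : ℂ) := by
    intro ℓ y
    rw [← Equiv.sum_comp e.symm.toLinearEquiv.toEquiv]
    refine Finset.sum_congr rfl fun x _ => ?_
    have hQ : Q (e.symm x) = ∑ i, w i * x i ^ 2 := by
      rw [e.symm.map_app]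
      simp [QuadraticMap.weightedSumSquares_apply, pow_two]
    have hl : ℓ (e.symm x) = ∑ i, ℓ (e.symm (Pi.single i 1)) * x i := by
      have := (ℓ ∘ₗ e.symm.toLinearEquiv.toLinearMap).pi_apply_eq_sum_univ x
      refine this.trans (Finset.sum_congr rfl fun i _ => ?_)
      have hi : (fun j => if i = j then (1 : ZMod p) else 0) = Pi.single i 1 := by
        funext j
        simp [Pi.single_apply, eq_comm]
      rw [smul_eq_mul, mul_comm, hi]
      rfl
    rw [Finset.sum_add_distrib, ← hQ, ← hl]
    rfl
  refine ⟨(univ.filter fun i => w i ≠ 0).card, ?_, ∏ i ∈ univ.filter fun i => w i ≠ 0,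
    qchar p (w i), ?_, ?_, ?_⟩
  · exact (Finset.card_filter_le _ _).trans (by simp)
  · refine Finset.prod_induction _ (fun z : ℂ => z = 1 ∨ z = -1) ?_ (Or.inl rfl) ?_
    · rintro a b (rfl | rfl) (rfl | rfl) <;> simp
    · intro i hi
      exact qchar_eq_one_or_neg_one (Finset.mem_filter.mp hi).2
  · intro y hy
    have h := key 0 y
    simp only [LinearMap.zero_apply, add_zero] at h
    rw [h, sum_stdAddChar_diagonal_eval hp w (fun _ => 0) (fun _ _ => rfl) y hy]
    simp
  · intro ℓ
    by_cases hc : ∀ i, w i = 0 → ℓ (e.symm (Pi.single i 1)) = 0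
    · right
      refine ⟨∑ i ∈ univ.filter fun i => w i ≠ 0,
        ℓ (e.symm (Pi.single i 1)) ^ 2 / (4 * w i), fun y hy => ?_⟩
      rw [key, sum_stdAddChar_diagonal_eval hp w _ hc y hy]
    · left
      push Not at hc
      obtain ⟨i, hw, hc⟩ := hc
      refine ⟨fun h => ?_, fun y hy => ?_⟩
      · have h' : (univ.filter fun i => w i ≠ 0).card = 
            (univ : Finset (Fin (Module.finrank (ZMod p) V))).card := by
          rw [h, Finset.card_univ, Fintype.card_fin]
        rw [Finset.card_filter_eq_iff] at h'
        exact h' i (Finset.mem_univ i) hw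
      · rw [key]
        exact sum_stdAddChar_diagonal_eq_zero w _ hw hc hy

end QuadraticForms

section FixedPoints

variable {p : ℕ} {F : Type*} [Field F]

theorem pow_prime_pow_gcd {x : F} {m n : ℕ} (hm : x ^ p ^ m = x) (hn : x ^ p ^ n = x) :
    x ^ p ^ m.gcd n = x := by
  have key : ∀ k, Function.IsPeriodicPt (fun x : F => x ^ p) k x ↔ x ^ p ^ k = x := by
    intro k
    rw [Function.IsPeriodicPt, Function.IsFixedPt, pow_iterate]
  exact (key _).mp (((key m).mpr hm).gcd ((key n).mpr hn))

theorem pow_prime_pow_mul {x : F} {m : ℕ} (hm : x ^ p ^ m = x) (k : ℕ) : x ^ p ^ (m * k) = x := by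
  induction k with
  | zero => simp
  | succ k ih => rw [Nat.mul_succ, pow_add, pow_mul, ih, hm]

theorem pow_prime_pow_of_card [Fintype F] {n : ℕ} (hF : Fintype.card F = p ^ n) (x : F) : x ^ p ^ n = x := by
  rw [← hF, FiniteField.pow_card]

theorem card_filter_pow_prime_pow_eq [Fact p.Prime] [Fintype F] [DecidableEq F] {n : ℕ} (hF : Fintype.card F = p ^ n)
    (k : ℕ) : (univ.filter fun x : F => x ^ p ^ k = x).card = p ^ n.gcd k := by
  have hp : 1 ≤ p := (Fact.out : p.Prime).one_le
  have h1 : Nat.card (powMonoidHom (p ^ k - 1) : Fˣ →* Fˣ).ker = p ^ n.gcd k - 1 := by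
    rw [IsCyclic.card_powMonoidHom_ker, Nat.card_units, Nat.card_eq_fintype_card, hF,
      Nat.pow_sub_one_gcd_pow_sub_one]
  have h2 : (univ.filter fun x : F => x ^ p ^ k = x)
      = insert 0 ((univ.filter fun u : Fˣ => u ^ (p ^ k - 1) = 1).map ⟨Units.val, Units.val_injective⟩) := by
    ext x
    have hk : p ^ k = (p ^ k - 1) + 1 := (Nat.sub_add_cancel (Nat.one_le_pow _ _ hp)).symm
    simp only [mem_filter, mem_univ, true_and, mem_insert, mem_map, Function.Embedding.coeFn_mk]
    constructor
    · intro hx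
      by_cases h0 : x = 0
      · exact Or.inl h0
      · refine Or.inr ⟨Units.mk0 x h0, ?_, rfl⟩
        rw [hk, pow_succ] at hx
        ext
        simpa using mul_right_cancel₀ h0 (hx.trans (one_mul x).symm)
    · rintro (rfl | ⟨u, hu, rfl⟩)
      · exact zero_pow (pow_ne_zero _ (by omega))
      · rw [hk, pow_succ, ← Units.val_pow_eq_pow_val, hu]
        simp
  rw [h2, card_insert_of_notMem (by simp), card_map]
  have h3 : (univ.filter fun u : Fˣ => u ^ (p ^ k - 1) = 1).card = p ^ n.gcd k - 1 := by
    rw [← h1]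
    exact (Nat.subtype_card _ (by simp [MonoidHom.mem_ker])).symm
  rw [h3, Nat.sub_add_cancel (Nat.one_le_pow _ _ hp)]

end FixedPoints

section Trace

variable {p : ℕ} [Fact p.Prime] {F : Type*} [Field F] [Algebra (ZMod p) F]

theorem trace_pow_prime_pow [Fintype F] (k : ℕ) (z : F) :
    Algebra.trace (ZMod p) F (z ^ p ^ k) = Algebra.trace (ZMod p) F z := by
  induction k with
  | zero => simp
  | succ k ih =>
    rw [pow_succ, pow_mul, ← ih]
    have h := Algebra.trace_eq_of_algEquiv (FiniteField.frobeniusAlgEquivOfAlgebraic (ZMod p) F)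
      (z ^ p ^ k)
    rw [FiniteField.coe_frobeniusAlgEquivOfAlgebraic] at h
    simpa [ZMod.card] using h

theorem exists_trace_mul_ne_zero [Fintype F] {z : F} (hz : z ≠ 0) :
    ∃ x, Algebra.trace (ZMod p) F (x * z) ≠ 0 := by
  by_contra! h
  refine hz ((traceForm_nondegenerate (ZMod p) F).1 z fun x => ?_)
  rw [Algebra.traceForm_apply, mul_comm, h]

theorem stdAddChar_ne_one {t : ZMod p} (ht : t ≠ 0) : (ZMod.stdAddChar t : ℂ) ≠ 1 := by
  intro h
  exact ht (ZMod.injective_stdAddChar (h.trans (AddChar.map_zero_eq_one _).symm))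

/-- Orthogonality relation on an additively closed set. -/
theorem sum_stdAddChar_trace_eq_zero (A : Finset F)
    (hadd : ∀ a ∈ A, ∀ b ∈ A, a + b ∈ A) (hneg : ∀ a ∈ A, -a ∈ A) {z a₀ : F} (ha₀ : a₀ ∈ A)
    (h : Algebra.trace (ZMod p) F (a₀ * z) ≠ 0) :
    ∑ a ∈ A, (ZMod.stdAddChar (Algebra.trace (ZMod p) F (a * z)) : ℂ) = 0 := by
  have h1 : (∑ a ∈ A, (ZMod.stdAddChar (Algebra.trace (ZMod p) F (a * z)) : ℂ))
      = ZMod.stdAddChar (Algebra.trace (ZMod p) F (a₀ * z)) *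
        ∑ a ∈ A, (ZMod.stdAddChar (Algebra.trace (ZMod p) F (a * z)) : ℂ) := by
    rw [mul_sum]
    refine sum_nbij' (fun a => -a₀ + a) (fun a => a₀ + a)
      (fun a ha => hadd _ (hneg _ ha₀) _ ha) (fun a ha => hadd _ ha₀ _ ha) (by simp) (by simp) ?_
    intro a _
    rw [← AddChar.map_add_eq_mul, ← map_add]
    congr 2
    ring
  have h2 := stdAddChar_ne_one h
  have h3 : (1 - (ZMod.stdAddChar (Algebra.trace (ZMod p) F (a₀ * z)) : ℂ)) *
      ∑ a ∈ A, (ZMod.stdAddChar (Algebra.trace (ZMod p) F (a * z)) : ℂ) = 0 := by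
    rw [sub_mul, ← h1]; ring
  exact (mul_eq_zero.mp h3).resolve_left (sub_ne_zero.mpr (Ne.symm h2))

theorem sum_stdAddChar_trace [Fintype F] [DecidableEq F] (z : F) :
    ∑ x : F, (ZMod.stdAddChar (Algebra.trace (ZMod p) F (x * z)) : ℂ)
      = if z = 0 then (Fintype.card F : ℂ) else 0 := by
  split_ifs with hz
  · simp [hz]
  · obtain ⟨x, hx⟩ := exists_trace_mul_ne_zero (p := p) hz
    exact sum_stdAddChar_trace_eq_zero univ (by simp) (by simp) (mem_univ x) hx

theorem sum_stdAddChar_trace_subfield [Fintype F] [CharP F p] [DecidableEq F] (hp : p ≠ 2) {s : ℕ}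
    (hF : Fintype.card F = p ^ (2 * s)) {z : F} (hz : z ^ p ^ s = z) :
    ∑ a ∈ univ.filter fun a : F => a ^ p ^ s = a,
      (ZMod.stdAddChar (Algebra.trace (ZMod p) F (a * z)) : ℂ)
      = if z = 0 then (p : ℂ) ^ s else 0 := by
  split_ifs with h0
  · simp [h0, card_filter_pow_prime_pow_eq hF]
  · obtain ⟨x, hx⟩ := exists_trace_mul_ne_zero (p := p) h0
    refine sum_stdAddChar_trace_eq_zero _ ?_ ?_ (a₀ := x + x ^ p ^ s) ?_ ?_
    · intro a ha b hb
      simp only [mem_filter, mem_univ, true_and] at *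
      rw [add_pow_char_pow, ha, hb]
    · intro a ha
      simp only [mem_filter, mem_univ, true_and] at *
      rw [neg_pow, ha, ((((Fact.out : p.Prime).odd_of_ne_two hp)).pow).neg_one_pow]
      ring
    · simp only [mem_filter, mem_univ, true_and]
      rw [add_pow_char_pow, ← pow_mul, ← pow_add, ← two_mul, pow_prime_pow_of_card hF, add_comm]
    · have h1 := trace_pow_prime_pow (p := p) s (x * z)
      rw [mul_pow, hz] at h1
      rw [add_mul, map_add, h1, ← two_mul]
      exact mul_ne_zero (two_ne_zero_zmod hp) hx

end Trace

theorem two_pow_prime_pow {p : ℕ} [Fact p.Prime] {F : Type*} [Field F] [CharP F p] (k : ℕ) :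
    (2 : F) ^ p ^ k = 2 := by
  rw [← one_add_one_eq_two, add_pow_char_pow, one_pow]

section Forms

variable {p : ℕ} [Fact p.Prime] {F : Type*} [Field F] [Algebra (ZMod p) F]

/-- The `ZMod p`-valued form `x ↦ Tr (a / 2 * x ^ (p ^ s + 1) + b * x ^ (p ^ l + 1))`. -/
noncomputable def traceForm₂ (p s l : ℕ) [Fact p.Prime] {F : Type*} [Field F]
    [Algebra (ZMod p) F] (a b x : F) : ZMod p :=
  Algebra.trace (ZMod p) F (a / 2 * x ^ (p ^ s + 1) + b * x ^ (p ^ l + 1))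

/-- The exponential sum of `y` times the form `traceForm₂`. -/
noncomputable def expSum (p s l : ℕ) [Fact p.Prime] {F : Type*} [Field F] [Fintype F]
    [Algebra (ZMod p) F] (y : ZMod p) (a b : F) : ℂ :=
  ∑ x : F, (ZMod.stdAddChar (y * traceForm₂ p s l a b x) : ℂ)

/-- The linearized polynomial describing the polar form of `traceForm₂`. -/
def polarPoly (p s l : ℕ) {F : Type*} [Field F] (a b x : F) : F :=
  a ^ p ^ l * x ^ p ^ (s + l) + b ^ p ^ l * x ^ p ^ (2 * l) + b * x

/-- The radical of `traceForm₂`. -/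
def radical (p s l : ℕ) {F : Type*} [Field F] [Fintype F] [DecidableEq F] (a b : F) : Finset F :=
  univ.filter fun x => polarPoly p s l a b x = 0

/-- The elements of `F` fixed by the `p ^ s` power map. -/
def fixedFinset (p s : ℕ) (F : Type*) [Field F] [Fintype F] [DecidableEq F] : Finset F :=
  univ.filter fun x => x ^ p ^ s = x

theorem two_ne_zero_of_algebra (p : ℕ) [Fact p.Prime] (F : Type*) [Field F] [Algebra (ZMod p) F]
    (hp : p ≠ 2) : (2 : F) ≠ 0 := by
  rw [← map_ofNat (algebraMap (ZMod p) F) 2]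
  exact (map_ne_zero_iff _ (algebraMap (ZMod p) F).injective).mpr (two_ne_zero_zmod hp)

theorem traceForm₂_zero (s l : ℕ) (a b : F) : traceForm₂ p s l a b 0 = 0 := by
  simp [traceForm₂]

theorem sum_stdAddChar_mul_trace [Fintype F] [DecidableEq F] {y : ZMod p} (hy : y ≠ 0) (z : F) :
    ∑ x : F, (ZMod.stdAddChar (y * Algebra.trace (ZMod p) F (x * z)) : ℂ)
      = if z = 0 then (Fintype.card F : ℂ) else 0 := by
  have h := sum_stdAddChar_trace (p := p) (algebraMap (ZMod p) F y * z)
  have hy' : algebraMap (ZMod p) F y ≠ 0 := by simpa using hy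
  simp only [mul_eq_zero, hy', false_or] at h
  rw [← h]
  refine sum_congr rfl fun x _ => ?_
  rw [← smul_eq_mul, ← map_smul, Algebra.smul_def]
  congr 2
  ring

variable [CharP F p] [Fintype F]

theorem traceForm₂_add (hp : p ≠ 2) {s : ℕ} (l : ℕ) (hF : Fintype.card F = p ^ (2 * s)) {a : F}
    (ha : a ^ p ^ s = a) (b x u : F) :
    traceForm₂ p s l a b (x + u) = traceForm₂ p s l a b x + traceForm₂ p s l a b u
      + Algebra.trace (ZMod p) F (polarPoly p s l a b x * u ^ p ^ l) := by
  have h2 := two_ne_zero_of_algebra p F hp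
  have e1 : a / 2 * (x + u) ^ (p ^ s + 1) + b * (x + u) ^ (p ^ l + 1)
      = (a / 2 * x ^ (p ^ s + 1) + b * x ^ (p ^ l + 1))
        + (a / 2 * u ^ (p ^ s + 1) + b * u ^ (p ^ l + 1))
        + (a / 2 * (x ^ p ^ s * u) + a / 2 * (u ^ p ^ s * x) + b * x ^ p ^ l * u
          + b * x * u ^ p ^ l) := by
    rw [pow_succ (x + u), pow_succ (x + u), add_pow_char_pow, add_pow_char_pow]
    ring
  have e2 : polarPoly p s l a b x * u ^ p ^ l
      = (a / 2 * (x ^ p ^ s * u)) ^ p ^ l + (a / 2 * (x ^ p ^ s * u)) ^ p ^ l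
        + (b * x ^ p ^ l * u) ^ p ^ l + b * x * u ^ p ^ l := by
    have e3 : (a / 2 * (x ^ p ^ s * u)) ^ p ^ l = a ^ p ^ l / 2 * (x ^ p ^ (s + l) * u ^ p ^ l) := by
      rw [mul_pow, div_pow, two_pow_prime_pow, mul_pow, ← pow_mul, ← pow_add]
    have e4 : (b * x ^ p ^ l * u) ^ p ^ l = b ^ p ^ l * x ^ p ^ (2 * l) * u ^ p ^ l := by
      rw [mul_pow, mul_pow, ← pow_mul, ← pow_add, two_mul]
    rw [e3, e4, polarPoly]
    field_simp
    ring
  have e5 : (a / 2 * (u ^ p ^ s * x)) ^ p ^ s = a / 2 * (x ^ p ^ s * u) := by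
    rw [mul_pow, div_pow, two_pow_prime_pow, ha, mul_pow, ← pow_mul, ← pow_add, ← two_mul,
      pow_prime_pow_of_card hF]
    ring
  have e6 := trace_pow_prime_pow (p := p) s (a / 2 * (u ^ p ^ s * x))
  rw [e5] at e6
  rw [traceForm₂, e1, e2]
  simp only [map_add, trace_pow_prime_pow, ← e6, traceForm₂]

theorem traceForm₂_eq_zero_of_polarPoly (hp : p ≠ 2) {s : ℕ} (l : ℕ)
    (hF : Fintype.card F = p ^ (2 * s)) {a : F} (ha : a ^ p ^ s = a) (b : F) {x : F}
    (hx : polarPoly p s l a b x = 0) : traceForm₂ p s l a b x = 0 := by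
  have hodd := (Fact.out : p.Prime).odd_of_ne_two hp
  have h1 := traceForm₂_add hp l hF ha b x (-x)
  have h2 : traceForm₂ p s l a b (-x) = traceForm₂ p s l a b x := by
    have : ∀ k, (-x) ^ (p ^ k + 1) = x ^ (p ^ k + 1) := fun k =>
      (hodd.pow.add_one).neg_pow x
    rw [traceForm₂, traceForm₂, this, this]
  rw [hx, h2, add_neg_cancel, traceForm₂_zero, zero_mul, map_zero, add_zero, ← two_mul] at h1
  exact (mul_eq_zero.mp h1.symm).resolve_left (two_ne_zero_zmod hp)

variable [DecidableEq F]

theorem sum_fixedFinset_stdAddChar_mul_trace (hp : p ≠ 2) {s : ℕ}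
    (hF : Fintype.card F = p ^ (2 * s)) {y : ZMod p} (hy : y ≠ 0) {z : F} (hz : z ^ p ^ s = z) :
    ∑ a ∈ fixedFinset p s F, (ZMod.stdAddChar (y * Algebra.trace (ZMod p) F (a * z)) : ℂ)
      = if z = 0 then (p : ℂ) ^ s else 0 := by
  have hy' : algebraMap (ZMod p) F y ≠ 0 := by simpa using hy
  have h := sum_stdAddChar_trace_subfield hp hF (z := algebraMap (ZMod p) F y * z) (by
    rw [mul_pow, hz, ← map_pow, ZMod.pow_card_pow])
  simp only [mul_eq_zero, hy', false_or] at h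
  rw [← h]
  refine sum_congr rfl fun x _ => ?_
  rw [← smul_eq_mul, ← map_smul, Algebra.smul_def]
  congr 2
  ring

theorem expSum_mul_expSum_neg (hp : p ≠ 2) {s : ℕ} (l : ℕ) (hF : Fintype.card F = p ^ (2 * s))
    {a : F} (ha : a ^ p ^ s = a) (b : F) {y : ZMod p} (hy : y ≠ 0) :
    expSum p s l y a b * expSum p s l (-y) a b
      = (p : ℂ) ^ (2 * s) * (radical p s l a b).card := by
  have hq : (p : ℂ) ^ (2 * s) = (Fintype.card F : ℂ) := by rw [hF]; push_cast; rfl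
  have h1 : expSum p s l y a b * expSum p s l (-y) a b
      = ∑ u : F, ∑ v : F, (ZMod.stdAddChar (y * traceForm₂ p s l a b u) : ℂ)
        * ZMod.stdAddChar (y * Algebra.trace (ZMod p) F (v ^ p ^ l * polarPoly p s l a b u)) := by
    rw [mul_comm, expSum, expSum, sum_mul_sum]
    refine Eq.trans (sum_congr rfl fun v _ => ?_) sum_comm
    rw [← Equiv.sum_comp (Equiv.addRight v)]
    refine sum_congr rfl fun u _ => ?_
    rw [Equiv.coe_addRight, traceForm₂_add hp l hF ha, ← AddChar.map_add_eq_mul,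
      ← AddChar.map_add_eq_mul, mul_comm (v ^ p ^ l)]
    congr 1
    ring
  rw [h1]
  simp only [← mul_sum]
  have h3 : ∀ z : F, ∑ v : F, (ZMod.stdAddChar (y * Algebra.trace (ZMod p) F (v ^ p ^ l * z)) : ℂ)
      = if z = 0 then (Fintype.card F : ℂ) else 0 := by
    intro z
    rw [← sum_stdAddChar_mul_trace hy]
    have hb : Function.Bijective fun v : F => v ^ p ^ l :=
      ⟨fun x v h => (iterateFrobenius_inj F p l) (by simpa [iterateFrobenius_def] using h),
       Finite.surjective_of_injective fun x v h =>
        (iterateFrobenius_inj F p l) (by simpa [iterateFrobenius_def] using h)⟩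
    exact (Equiv.ofBijective _ hb).sum_comp
      fun v => (ZMod.stdAddChar (y * Algebra.trace (ZMod p) F (v * z)) : ℂ)
  simp only [h3, mul_ite, mul_zero]
  rw [← sum_filter, sum_congr rfl (g := fun _ => (Fintype.card F : ℂ)), sum_const, nsmul_eq_mul,
    hq, mul_comm, radical]
  intro u hu
  rw [traceForm₂_eq_zero_of_polarPoly hp l hF ha b (mem_filter.mp hu).2]
  simp

end Forms

theorem gcd_add_two_mul_left (s l : ℕ) : (s + l).gcd (2 * s) = (s + l).gcd (2 * l) := by
  have key : ∀ {g a b : ℕ}, g ∣ a + b → g ∣ 2 * a → g ∣ 2 * b := by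
    intro g a b h1 h2
    have h3 : g ∣ 2 * a + 2 * b := by rw [← mul_add]; exact h1.mul_left 2
    exact (Nat.dvd_add_right h2).mp h3
  refine Nat.dvd_antisymm (Nat.dvd_gcd (Nat.gcd_dvd_left _ _) ?_)
    (Nat.dvd_gcd (Nat.gcd_dvd_left _ _) ?_)
  · exact key (Nat.gcd_dvd_left _ _) (Nat.gcd_dvd_right _ _)
  · exact key (by rw [add_comm]; exact Nat.gcd_dvd_left _ _) (Nat.gcd_dvd_right _ _)

section Fields

variable {p : ℕ} [Fact p.Prime] {F : Type*} [Field F] [CharP F p]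

theorem pow_prime_pow_injective (k : ℕ) : Function.Injective fun x : F => x ^ p ^ k :=
  fun x v h => (iterateFrobenius_inj F p k) (by simpa [iterateFrobenius_def] using h)

omit [CharP F p] in
theorem neg_pow_prime_pow (hp : p ≠ 2) (k : ℕ) (x : F) : (-x) ^ p ^ k = -x ^ p ^ k :=
  (((Fact.out : p.Prime).odd_of_ne_two hp).pow).neg_pow x

variable [Fintype F]

omit [Fact p.Prime] [CharP F p] in
theorem pow_prime_pow_eq_of_pow_add {s l d : ℕ} (hF : Fintype.card F = p ^ (2 * s))
    (hd' : (s + l).gcd (2 * l) = d) {x : F} (hx : x ^ p ^ (s + l) = x) : x ^ p ^ d = x := by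
  rw [← hd', ← gcd_add_two_mul_left]
  exact pow_prime_pow_gcd hx (pow_prime_pow_of_card hF x)

omit [Fact p.Prime] [CharP F p] in
theorem pow_prime_pow_eq_of_pow_add' {s l d : ℕ} (hF : Fintype.card F = p ^ (2 * s))
    (hd : s.gcd l = d) (hd' : (s + l).gcd (2 * l) = d) {x : F} (hx : x ^ p ^ (s + l) = x) :
    x ^ p ^ s = x := by
  obtain ⟨k, hk⟩ : d ∣ s := hd ▸ Nat.gcd_dvd_left s l
  rw [hk]
  exact pow_prime_pow_mul (pow_prime_pow_eq_of_pow_add hF hd' hx) k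

omit [CharP F p] in
theorem eq_zero_of_pow_eq_nonsquare_mul [Algebra (ZMod p) F] (hp : p ≠ 2) {s l d : ℕ}
    (hF : Fintype.card F = p ^ (2 * s))
    (hd : s.gcd l = d) (hd' : (s + l).gcd (2 * l) = d) (hodd : Odd d) {ν : ZMod p}
    (hν : ¬ IsSquare ν) {x v : F}
    (h1 : x ^ (p ^ s + 1) = algebraMap (ZMod p) F ν * v ^ (p ^ s + 1))
    (h2 : x ^ (p ^ l + 1) = algebraMap (ZMod p) F ν * v ^ (p ^ l + 1)) : x = 0 ∧ v = 0 := by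
  have hν0 : ν ≠ 0 := by rintro rfl; exact hν (IsSquare.zero)
  by_cases hv : v = 0
  · subst hv
    rw [zero_pow (Nat.succ_ne_zero _), mul_zero] at h1
    exact ⟨eq_zero_of_pow_eq_zero h1, rfl⟩
  exfalso
  set c := algebraMap (ZMod p) F ν with hc
  have hc0 : c ≠ 0 := by simpa [hc] using hν0
  obtain ⟨t, rfl⟩ : ∃ t, x = t * v := ⟨x / v, (div_mul_cancel₀ x hv).symm⟩
  rw [mul_pow] at h1 h2
  have h3 := mul_right_cancel₀ (pow_ne_zero _ hv) h1
  have h4 := mul_right_cancel₀ (pow_ne_zero _ hv) h2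
  have ht : t ≠ 0 := by
    rintro rfl
    rw [zero_pow (Nat.succ_ne_zero _)] at h3
    exact hc0 h3.symm
  have h5 : t ^ p ^ s = t ^ p ^ l := by
    rw [← h4, pow_succ, pow_succ] at h3
    exact mul_right_cancel₀ ht h3
  have h6 : t ^ p ^ (s + l) = t := by
    rw [add_comm, pow_add, pow_mul, ← h5, ← pow_mul, ← pow_add, ← two_mul, pow_prime_pow_of_card hF]
  have h7 : t * t = c := by
    rw [pow_succ, pow_prime_pow_eq_of_pow_add' hF hd hd' h6] at h3
    exact h3
  have h8 : c ^ (p / 2) = -1 := by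
    rw [hc, ← map_pow, (ZMod.pow_div_two_eq_neg_one_or_one p hν0).resolve_left
      (fun h => hν ((ZMod.euler_criterion p hν0).mpr h)), map_neg, map_one]
  have h9 : t ^ p = -t := by
    have hp' : p = 2 * (p / 2) + 1 :=
      (Nat.two_mul_div_two_add_one_of_odd ((Fact.out : p.Prime).odd_of_ne_two hp)).symm
    have : t ^ p = (t * t) ^ (p / 2) * t := by
      conv_lhs => rw [hp']
      rw [pow_succ, pow_mul, pow_two]
    rw [this, h7, h8, neg_one_mul]
  have h10 : ∀ k, t ^ p ^ k = (-1) ^ k * t := by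
    intro k
    induction k with
    | zero => simp
    | succ k ih =>
      rw [pow_succ, pow_mul, ih, mul_pow, h9, ← pow_mul, mul_comm k p, pow_mul,
        ((Fact.out : p.Prime).odd_of_ne_two hp).neg_one_pow, pow_succ]
      ring
  have h11 := pow_prime_pow_eq_of_pow_add hF hd' h6
  rw [h10, hodd.neg_one_pow, neg_one_mul] at h11
  have h12 : 2 * t = 0 := by linear_combination -h11
  exact (mul_ne_zero (two_ne_zero_of_algebra p F hp) ht) h12

theorem pow_prime_pow_eq_of_polar [Algebra (ZMod p) F] (hp : p ≠ 2) {s l d : ℕ}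
    (hF : Fintype.card F = p ^ (2 * s))
    (hd : s.gcd l = d) (hd' : (s + l).gcd (2 * l) = d) {a b : F} (ha : a ^ p ^ s = a)
    (h : a ^ p ^ l + b ^ p ^ l + b = 0) : b ^ p ^ s = b := by
  have h1 : a ^ p ^ l + (b ^ p ^ s) ^ p ^ l + b ^ p ^ s = 0 := by
    have h2 := congrArg (fun z : F => z ^ p ^ s) h
    rw [add_pow_char_pow, add_pow_char_pow, zero_pow (pow_ne_zero _ (Fact.out : p.Prime).ne_zero),
      pow_right_comm a, ha, pow_right_comm b] at h2
    exact h2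
  have h3 : (b - b ^ p ^ s) ^ p ^ s = -(b - b ^ p ^ s) := by
    rw [sub_pow_char_pow, ← pow_mul, ← pow_add, ← two_mul, pow_prime_pow_of_card hF]
    ring
  have h4 : (b - b ^ p ^ s) ^ p ^ l = -(b - b ^ p ^ s) := by
    rw [sub_pow_char_pow]
    linear_combination h - h1
  have h5 : (b - b ^ p ^ s) ^ p ^ (s + l) = b - b ^ p ^ s := by
    rw [pow_add, pow_mul, h3, neg_pow_prime_pow hp, h4, neg_neg]
  have h6 := pow_prime_pow_eq_of_pow_add' hF hd hd' h5
  have h7 : 2 * (b - b ^ p ^ s) = 0 := by linear_combination h3 - h6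
  exact (sub_eq_zero.mp ((mul_eq_zero.mp h7).resolve_left (two_ne_zero_of_algebra p F hp))).symm

end Fields

section Moments

variable {p : ℕ} [Fact p.Prime] {F : Type*} [Field F] [Algebra (ZMod p) F] [CharP F p]
  [Fintype F] [DecidableEq F]

omit [Fact p.Prime] [Algebra (ZMod p) F] [CharP F p] in
theorem mem_fixedFinset {s : ℕ} {a : F} : a ∈ fixedFinset p s F ↔ a ^ p ^ s = a := by
  simp [fixedFinset]

omit [Algebra (ZMod p) F] [CharP F p] in
theorem card_fixedFinset {s : ℕ} (hF : Fintype.card F = p ^ (2 * s)) :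
    (fixedFinset p s F).card = p ^ s := by
  rw [fixedFinset, card_filter_pow_prime_pow_eq hF, Nat.gcd_mul_left_left]

omit [Fact p.Prime] [Algebra (ZMod p) F] [CharP F p] [DecidableEq F] in
theorem norm_pow_prime_pow {s : ℕ} (hF : Fintype.card F = p ^ (2 * s)) (x : F) :
    (x ^ (p ^ s + 1)) ^ p ^ s = x ^ (p ^ s + 1) := by
  rw [pow_succ, mul_pow, ← pow_mul x, ← pow_add p, ← two_mul, pow_prime_pow_of_card hF, mul_comm]

theorem sum_sum_stdAddChar (hp : p ≠ 2) {s : ℕ} (hF : Fintype.card F = p ^ (2 * s))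
    {y : ZMod p} (hy : y ≠ 0) {z : F} (hz : z ^ p ^ s = z) (z' : F) :
    ∑ a ∈ fixedFinset p s F, ∑ b : F,
      (ZMod.stdAddChar (y * Algebra.trace (ZMod p) F (a * z + b * z')) : ℂ)
      = if z = 0 ∧ z' = 0 then (p : ℂ) ^ (3 * s) else 0 := by
  simp only [map_add, mul_add, AddChar.map_add_eq_mul]
  rw [← sum_mul_sum, sum_fixedFinset_stdAddChar_mul_trace hp hF hy hz,
    sum_stdAddChar_mul_trace hy, hF]
  by_cases h1 : z = 0 <;> by_cases h2 : z' = 0 <;> simp [h1, h2]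
  ring

theorem sum_expSum (hp : p ≠ 2) {s : ℕ} (l : ℕ) (hF : Fintype.card F = p ^ (2 * s))
    {y : ZMod p} (hy : y ≠ 0) :
    ∑ a ∈ fixedFinset p s F, ∑ b : F, expSum p s l y a b = (p : ℂ) ^ (3 * s) := by
  have h2 := two_ne_zero_of_algebra p F hp
  simp only [expSum]
  have h1 : ∑ a ∈ fixedFinset p s F, ∑ b : F, ∑ x : F,
      (ZMod.stdAddChar (y * traceForm₂ p s l a b x) : ℂ)
      = ∑ x : F, ∑ a ∈ fixedFinset p s F, ∑ b : F, (ZMod.stdAddChar (y *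
        Algebra.trace (ZMod p) F (a * (x ^ (p ^ s + 1) / 2) + b * x ^ (p ^ l + 1))) : ℂ) := by
    rw [sum_comm (s := univ)]
    refine sum_congr rfl fun a _ => ?_
    rw [sum_comm]
    refine sum_congr rfl fun b _ => sum_congr rfl fun x _ => ?_
    rw [traceForm₂]
    congr 4
    ring
  rw [h1, sum_congr rfl fun x _ => sum_sum_stdAddChar hp hF hy
    (by rw [div_pow, two_pow_prime_pow, norm_pow_prime_pow hF]) _]
  rw [sum_eq_single 0]
  · simp
  · intro x _ hx
    simp [hx]
  · simp

theorem sum_expSum_mul_expSum (hp : p ≠ 2) {s l d : ℕ} (hF : Fintype.card F = p ^ (2 * s))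
    (hd : s.gcd l = d) (hd' : (s + l).gcd (2 * l) = d) (hodd : Odd d) {ν : ZMod p}
    (hν : ¬ IsSquare ν) :
    ∑ a ∈ fixedFinset p s F, ∑ b : F, expSum p s l 1 a b * expSum p s l (-ν) a b
      = (p : ℂ) ^ (3 * s) := by
  have h2 := two_ne_zero_of_algebra p F hp
  have h1 : ∑ a ∈ fixedFinset p s F, ∑ b : F, expSum p s l 1 a b * expSum p s l (-ν) a b
      = ∑ x : F, ∑ v : F, ∑ a ∈ fixedFinset p s F, ∑ b : F, (ZMod.stdAddChar (1 *
        Algebra.trace (ZMod p) F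
        (a * ((x ^ (p ^ s + 1) - algebraMap (ZMod p) F ν * v ^ (p ^ s + 1)) / 2)
          + b * (x ^ (p ^ l + 1) - algebraMap (ZMod p) F ν * v ^ (p ^ l + 1)))) : ℂ) := by
    simp only [expSum, sum_mul_sum]
    have h3 : ∀ g : F → F → F → F → ℂ, ∑ a ∈ fixedFinset p s F, ∑ b, ∑ x, ∑ v, g a b x v
        = ∑ x, ∑ v, ∑ a ∈ fixedFinset p s F, ∑ b, g a b x v := by
      intro g
      calc ∑ a ∈ fixedFinset p s F, ∑ b, ∑ x, ∑ v, g a b x v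
          = ∑ a ∈ fixedFinset p s F, ∑ x, ∑ v, ∑ b, g a b x v := by
            refine sum_congr rfl fun a _ => ?_
            rw [sum_comm]
            exact sum_congr rfl fun x _ => sum_comm
        _ = _ := by
            rw [sum_comm]
            exact sum_congr rfl fun x _ => sum_comm
    rw [h3]
    refine sum_congr rfl fun x _ => sum_congr rfl fun v _ => sum_congr rfl fun a _ =>
      sum_congr rfl fun b _ => ?_
    rw [traceForm₂, traceForm₂, ← AddChar.map_add_eq_mul]
    congr 1
    rw [neg_mul, ← smul_eq_mul ν, ← map_smul, one_mul, one_mul, ← sub_eq_add_neg, ← map_sub,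
      Algebra.smul_def]
    congr 1
    ring
  have hN : ∀ x v : F, ((x ^ (p ^ s + 1) - algebraMap (ZMod p) F ν * v ^ (p ^ s + 1)) / 2) ^ p ^ s
      = (x ^ (p ^ s + 1) - algebraMap (ZMod p) F ν * v ^ (p ^ s + 1)) / 2 := by
    intro x v
    rw [div_pow, two_pow_prime_pow, sub_pow_char_pow, norm_pow_prime_pow hF, mul_pow,
      norm_pow_prime_pow hF, ← map_pow, ZMod.pow_card_pow]
  rw [h1, sum_congr rfl fun x _ => sum_congr rfl fun v _ =>
    sum_sum_stdAddChar hp hF one_ne_zero (hN x v) _]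
  have h4 : ∀ x v : F, ((x ^ (p ^ s + 1) - algebraMap (ZMod p) F ν * v ^ (p ^ s + 1)) / 2 = 0 ∧
      x ^ (p ^ l + 1) - algebraMap (ZMod p) F ν * v ^ (p ^ l + 1) = 0) ↔ (x = 0 ∧ v = 0) := by
    intro x v
    constructor
    · rintro ⟨h5, h6⟩
      exact eq_zero_of_pow_eq_nonsquare_mul hp hF hd hd' hodd hν
        (sub_eq_zero.mp ((div_eq_zero_iff.mp h5).resolve_right h2)) (sub_eq_zero.mp h6)
    · rintro ⟨rfl, rfl⟩
      simp
  simp only [h4, ite_and]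
  simp

omit [Fact p.Prime] [Algebra (ZMod p) F] [CharP F p] [Fintype F] [DecidableEq F] in
theorem polarPoly_mul (s l : ℕ) (a b w : F) :
    polarPoly p s l a b w * w ^ p ^ l = (a * w ^ (p ^ s + 1)) ^ p ^ l
      + (b * w ^ (p ^ l + 1)) ^ p ^ l + b * w ^ (p ^ l + 1) := by
  rw [polarPoly, mul_pow, mul_pow, ← pow_mul, ← pow_mul, two_mul, pow_add p, pow_add p, add_mul,
    add_mul, add_mul, add_mul, one_mul, pow_add, pow_add w (p ^ l * p ^ l), pow_succ w (p ^ l)]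
  ring

/-- Fibration of the pairs `((a, b), w)` with `w` in the radical over the nonzero `w`. -/
theorem sum_mul_card_radical (hp : p ≠ 2) {s l d : ℕ} (hl : l ≤ 2 * s)
    (hF : Fintype.card F = p ^ (2 * s))
    (hd : s.gcd l = d) (hd' : (s + l).gcd (2 * l) = d) (g : F → F → ℂ) :
    ∑ a ∈ fixedFinset p s F, ∑ b : F, g a b * (radical p s l a b).card
      = ∑ a ∈ fixedFinset p s F, ∑ b : F, g a b
        + ∑ w ∈ univ.erase (0 : F), ∑ β ∈ fixedFinset p s F,
          g (-(β ^ p ^ l + β) / w ^ (p ^ s + 1)) (β ^ p ^ l / w ^ (p ^ l + 1)) := by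
  have h1 : ∑ a ∈ fixedFinset p s F, ∑ b : F, g a b * (radical p s l a b).card
      = ∑ w : F, ∑ t ∈ fixedFinset p s F ×ˢ univ with polarPoly p s l t.1 t.2 w = 0,
        g t.1 t.2 := by
    simp only [sum_filter]
    symm
    rw [sum_comm, sum_product]
    refine sum_congr rfl fun a _ => sum_congr rfl fun b _ => ?_
    rw [← sum_filter, sum_const, nsmul_eq_mul, mul_comm, radical]
  rw [h1, ← add_sum_erase _ _ (mem_univ (0 : F))]
  congr 1
  · rw [filter_true_of_mem, sum_product]
    intro t _
    simp [polarPoly, (Fact.out : p.Prime).ne_zero]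
  · refine sum_congr rfl fun w hw => ?_
    have hw : w ≠ 0 := (mem_erase.mp hw).1
    have hw1 : w ^ (p ^ s + 1) ≠ 0 := pow_ne_zero _ hw
    have hw2 : w ^ (p ^ l + 1) ≠ 0 := pow_ne_zero _ hw
    symm
    refine sum_nbij (fun β => (-(β ^ p ^ l + β) / w ^ (p ^ s + 1), β ^ p ^ l / w ^ (p ^ l + 1)))
      ?_ ?_ ?_ (fun _ _ => rfl)
    · intro β hβ
      rw [mem_fixedFinset] at hβ
      simp only [mem_filter, mem_product, mem_univ, and_true, mem_fixedFinset]
      constructor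
      · rw [div_pow, norm_pow_prime_pow hF, neg_pow_prime_pow hp, add_pow_char_pow,
          pow_right_comm, hβ]
      · have h := polarPoly_mul (p := p) s l (-(β ^ p ^ l + β) / w ^ (p ^ s + 1))
          (β ^ p ^ l / w ^ (p ^ l + 1)) w
        rw [div_mul_cancel₀ _ hw1, div_mul_cancel₀ _ hw2, neg_pow_prime_pow hp,
          add_pow_char_pow] at h
        have h' : polarPoly p s l (-(β ^ p ^ l + β) / w ^ (p ^ s + 1))
          (β ^ p ^ l / w ^ (p ^ l + 1)) w * w ^ p ^ l = 0 := by rw [h]; ring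
        exact (mul_eq_zero.mp h').resolve_right (pow_ne_zero _ hw)
    · intro β _ β' _ h
      simp only [Prod.mk.injEq] at h
      exact pow_prime_pow_injective (p := p) l ((div_left_inj' hw2).mp h.2)
    · rintro ⟨a, b⟩ h
      simp only [coe_filter, mem_product, mem_univ, and_true, mem_fixedFinset,
        Set.mem_ofPred_eq] at h
      obtain ⟨ha, h⟩ := h
      have h3 := polarPoly_mul (p := p) s l a b w
      rw [h, zero_mul] at h3
      have ha1 : (a * w ^ (p ^ s + 1)) ^ p ^ s = a * w ^ (p ^ s + 1) := by
        rw [mul_pow, ha, norm_pow_prime_pow hF]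
      have hb1 := pow_prime_pow_eq_of_polar hp hF hd hd' ha1 h3.symm
      set b1 := b * w ^ (p ^ l + 1) with hb1'
      have hβ : (b1 ^ p ^ (2 * s - l)) ^ p ^ l = b1 := by
        rw [← pow_mul, ← pow_add, Nat.sub_add_cancel hl, pow_prime_pow_of_card hF]
      refine ⟨b1 ^ p ^ (2 * s - l), ?_, ?_⟩
      · rw [mem_coe, mem_fixedFinset, pow_right_comm, hb1]
      · have h4 : a * w ^ (p ^ s + 1) = -(b1 + b1 ^ p ^ (2 * s - l)) := by
          refine pow_prime_pow_injective (p := p) l ?_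
          simp only
          rw [neg_pow_prime_pow hp, add_pow_char_pow, hβ]
          linear_combination -h3
        simp only [hβ, ← h4, Prod.mk.injEq]
        exact ⟨mul_div_cancel_right₀ _ hw1, mul_div_cancel_right₀ _ hw2⟩

theorem sum_card_radical (hp : p ≠ 2) {s l d : ℕ} (hl : l ≤ 2 * s)
    (hF : Fintype.card F = p ^ (2 * s))
    (hd : s.gcd l = d) (hd' : (s + l).gcd (2 * l) = d) :
    ∑ a ∈ fixedFinset p s F, ∑ b : F, ((radical p s l a b).card : ℂ)
      = (p : ℂ) ^ (3 * s) + ((p : ℂ) ^ (2 * s) - 1) * (p : ℂ) ^ s := by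
  have h := sum_mul_card_radical hp hl hF hd hd' (fun _ _ => 1)
  simp only [one_mul] at h
  rw [h]
  have h1 : 1 ≤ p ^ (2 * s) := Nat.one_le_pow _ _ (Fact.out : p.Prime).pos
  simp [card_fixedFinset hF, hF, Nat.cast_sub h1]
  ring

omit [CharP F p] [DecidableEq F] in
theorem expSum_div (s l : ℕ) (y : ZMod p) (a b : F) {w : F} (hw : w ≠ 0) :
    expSum p s l y (a / w ^ (p ^ s + 1)) (b / w ^ (p ^ l + 1)) = expSum p s l y a b := by
  rw [expSum, ← Equiv.sum_comp (Equiv.mulLeft₀ w hw), expSum]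
  refine sum_congr rfl fun x _ => ?_
  rw [Equiv.mulLeft₀_apply, traceForm₂, traceForm₂, mul_pow, mul_pow]
  congr 3
  field_simp

theorem sum_fixedFinset_expSum (hp : p ≠ 2) {s l d : ℕ}
    (hF : Fintype.card F = p ^ (2 * s))
    (hd' : (s + l).gcd (2 * l) = d) {y : ZMod p} (hy : y ≠ 0) :
    ∑ β ∈ fixedFinset p s F, expSum p s l y (-(β ^ p ^ l + β)) (β ^ p ^ l)
      = (p : ℂ) ^ (s + d) := by
  have h2 := two_ne_zero_of_algebra p F hp
  have hform : ∀ β ∈ fixedFinset p s F, ∀ x : F,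
      traceForm₂ p s l (-(β ^ p ^ l + β)) (β ^ p ^ l) x
      = Algebra.trace (ZMod p) F
        (β ^ p ^ l * ((x - x ^ p ^ (s + l)) * (x ^ p ^ l - x ^ p ^ s) / 2)) := by
    intro β hβ x
    rw [mem_fixedFinset] at hβ
    have e1 : -(β ^ p ^ l + β) / 2 * x ^ (p ^ s + 1) + β ^ p ^ l * x ^ (p ^ l + 1)
        = -(β ^ p ^ l / 2 * x ^ (p ^ s + 1)) - β / 2 * x ^ (p ^ s + 1)
          + β ^ p ^ l / 2 * x ^ (p ^ l + 1) + β ^ p ^ l / 2 * x ^ (p ^ l + 1) := by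
      field_simp
      ring
    have e2 : β ^ p ^ l * ((x - x ^ p ^ (s + l)) * (x ^ p ^ l - x ^ p ^ s) / 2)
        = -(β ^ p ^ l / 2 * x ^ (p ^ s + 1)) - (β / 2 * x ^ (p ^ s + 1)) ^ p ^ l
          + β ^ p ^ l / 2 * x ^ (p ^ l + 1) + (β ^ p ^ l / 2 * x ^ (p ^ l + 1)) ^ p ^ s := by
      have e3 : (β / 2 * x ^ (p ^ s + 1)) ^ p ^ l
          = β ^ p ^ l / 2 * (x ^ p ^ (s + l) * x ^ p ^ l) := by
        rw [mul_pow, div_pow, two_pow_prime_pow, pow_succ, mul_pow, ← pow_mul x, ← pow_add p]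
      have e4 : (β ^ p ^ l / 2 * x ^ (p ^ l + 1)) ^ p ^ s
          = β ^ p ^ l / 2 * (x ^ p ^ (s + l) * x ^ p ^ s) := by
        rw [mul_pow, div_pow, two_pow_prime_pow, pow_succ, mul_pow, ← pow_mul x, ← pow_add p,
          pow_right_comm, hβ, add_comm l]
      rw [e3, e4]
      ring
    rw [traceForm₂, e1, e2]
    simp only [map_add, map_sub, map_neg, trace_pow_prime_pow]
  have hfix : ∀ x : F, ((x - x ^ p ^ (s + l)) * (x ^ p ^ l - x ^ p ^ s) / 2) ^ p ^ s
      = (x - x ^ p ^ (s + l)) * (x ^ p ^ l - x ^ p ^ s) / 2 := by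
    intro x
    have e1 : (x ^ p ^ (s + l)) ^ p ^ s = x ^ p ^ l := by
      rw [← pow_mul, ← pow_add, show s + l + s = 2 * s + l by ring, pow_add, pow_mul,
        pow_prime_pow_of_card hF]
    rw [div_pow, two_pow_prime_pow, mul_pow, sub_pow_char_pow, sub_pow_char_pow, e1,
      ← pow_mul x, ← pow_add, ← pow_mul x, ← pow_add, ← two_mul, pow_prime_pow_of_card hF,
      add_comm l]
    ring
  have hzero : ∀ x : F, (x - x ^ p ^ (s + l)) * (x ^ p ^ l - x ^ p ^ s) / 2 = 0
      ↔ x ^ p ^ (s + l) = x := by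
    intro x
    constructor
    · intro h
      rcases mul_eq_zero.mp ((div_eq_zero_iff.mp h).resolve_right h2) with h | h
      · exact (sub_eq_zero.mp h).symm
      · rw [add_comm, pow_add, pow_mul, sub_eq_zero.mp h, ← pow_mul, ← pow_add, ← two_mul,
          pow_prime_pow_of_card hF]
    · intro h
      rw [h, sub_self, zero_mul, zero_div]
  have hpow : ∀ G : F → ℂ, ∑ β ∈ fixedFinset p s F, G (β ^ p ^ l)
      = ∑ β ∈ fixedFinset p s F, G β := by
    intro G
    have himg : (fixedFinset p s F).image (fun β => β ^ p ^ l) = fixedFinset p s F := by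
      refine eq_of_subset_of_card_le ?_
        (card_image_of_injective _ (pow_prime_pow_injective l)).ge
      intro z hz
      obtain ⟨β, hβ, rfl⟩ := mem_image.mp hz
      rw [mem_fixedFinset] at *
      rw [pow_right_comm, hβ]
    conv_rhs => rw [← himg]
    rw [sum_image fun _ _ _ _ h => pow_prime_pow_injective l h]
  have h3 : ∑ β ∈ fixedFinset p s F, expSum p s l y (-(β ^ p ^ l + β)) (β ^ p ^ l)
      = ∑ x : F, ∑ β ∈ fixedFinset p s F, (ZMod.stdAddChar (y * Algebra.trace (ZMod p) F
        (β * ((x - x ^ p ^ (s + l)) * (x ^ p ^ l - x ^ p ^ s) / 2))) : ℂ) := by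
    simp only [expSum]
    rw [sum_comm]
    refine sum_congr rfl fun x _ => ?_
    rw [← hpow fun β => (ZMod.stdAddChar (y * Algebra.trace (ZMod p) F
      (β * ((x - x ^ p ^ (s + l)) * (x ^ p ^ l - x ^ p ^ s) / 2))) : ℂ)]
    exact sum_congr rfl fun β hβ => by rw [hform β hβ]
  rw [h3, sum_congr rfl fun x _ => sum_fixedFinset_stdAddChar_mul_trace hp hF hy (hfix x)]
  simp only [hzero]
  rw [← sum_filter, sum_const, nsmul_eq_mul, card_filter_pow_prime_pow_eq hF, Nat.gcd_comm,
    gcd_add_two_mul_left, hd']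
  push_cast
  ring

theorem sum_expSum_mul_card_radical (hp : p ≠ 2) {s l d : ℕ} (hl : l ≤ 2 * s)
    (hF : Fintype.card F = p ^ (2 * s))
    (hd : s.gcd l = d) (hd' : (s + l).gcd (2 * l) = d) {y : ZMod p} (hy : y ≠ 0) :
    ∑ a ∈ fixedFinset p s F, ∑ b : F, expSum p s l y a b * (radical p s l a b).card
      = (p : ℂ) ^ (3 * s) + ((p : ℂ) ^ (2 * s) - 1) * (p : ℂ) ^ (s + d) := by
  rw [sum_mul_card_radical hp hl hF hd hd', sum_expSum hp l hF hy]
  congr 1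
  rw [sum_congr rfl fun w hw => (sum_congr rfl fun β _ =>
    expSum_div s l y _ _ (mem_erase.mp hw).1).trans (sum_fixedFinset_expSum hp hF hd' hy)]
  have h1 : 1 ≤ p ^ (2 * s) := Nat.one_le_pow _ _ (Fact.out : p.Prime).pos
  simp [hF, Nat.cast_sub h1]

end Moments

section RadicalSize

variable {p : ℕ} [Fact p.Prime] {F : Type*} [Field F] [CharP F p] [Fintype F] [DecidableEq F]

omit [Fact p.Prime] [CharP F p] in
theorem mem_radical {s l : ℕ} {a b x : F} : x ∈ radical p s l a b ↔ polarPoly p s l a b x = 0 := by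
  simp [radical]

/-- The subfield of the elements fixed by the `p ^ d` power map. -/
def fixedSubfield (p d : ℕ) [Fact p.Prime] (F : Type*) [Field F] [CharP F p] : Subfield F where
  carrier := {x | x ^ p ^ d = x}
  mul_mem' {x y} hx hy := by
    change (x * y) ^ p ^ d = x * y
    rw [mul_pow, show x ^ p ^ d = x from hx, show y ^ p ^ d = y from hy]
  one_mem' := one_pow _
  add_mem' {x y} hx hy := by
    change (x + y) ^ p ^ d = x + y
    rw [add_pow_char_pow, show x ^ p ^ d = x from hx, show y ^ p ^ d = y from hy]
  zero_mem' := zero_pow (pow_ne_zero _ (Fact.out : p.Prime).ne_zero)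
  neg_mem' {x} hx := by
    change (-x) ^ p ^ d = -x
    rw [← zero_sub, sub_pow_char_pow, show x ^ p ^ d = x from hx,
      zero_pow (pow_ne_zero _ (Fact.out : p.Prime).ne_zero)]
  inv_mem' x hx := by
    change x⁻¹ ^ p ^ d = x⁻¹
    rw [inv_pow, show x ^ p ^ d = x from hx]

/-- The radical as a subspace over the fixed subfield. -/
def radicalSubmodule (p s l d : ℕ) [Fact p.Prime] {F : Type*} [Field F] [CharP F p] (hs : d ∣ s)
    (hl : d ∣ l) (a b : F) : Submodule (fixedSubfield p d F) F where
  carrier := {x | polarPoly p s l a b x = 0}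
  add_mem' {x y} hx hy := by
    have hx : a ^ p ^ l * x ^ p ^ (s + l) + b ^ p ^ l * x ^ p ^ (2 * l) + b * x = 0 := hx
    have hy : a ^ p ^ l * y ^ p ^ (s + l) + b ^ p ^ l * y ^ p ^ (2 * l) + b * y = 0 := hy
    change a ^ p ^ l * (x + y) ^ p ^ (s + l) + b ^ p ^ l * (x + y) ^ p ^ (2 * l) + b * (x + y) = 0
    rw [add_pow_char_pow, add_pow_char_pow]
    linear_combination hx + hy
  zero_mem' := by simp [polarPoly, (Fact.out : p.Prime).ne_zero]
  smul_mem' c x hx := by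
    have hx : a ^ p ^ l * x ^ p ^ (s + l) + b ^ p ^ l * x ^ p ^ (2 * l) + b * x = 0 := hx
    change a ^ p ^ l * ((c : F) * x) ^ p ^ (s + l) + b ^ p ^ l * ((c : F) * x) ^ p ^ (2 * l)
      + b * ((c : F) * x) = 0
    obtain ⟨i, hi⟩ : d ∣ s + l := dvd_add hs hl
    obtain ⟨j, hj⟩ : d ∣ 2 * l := hl.mul_left 2
    have hc : (c : F) ^ p ^ d = c := c.2
    rw [mul_pow, mul_pow, hi, hj, pow_prime_pow_mul hc, pow_prime_pow_mul hc, ← hi, ← hj]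
    linear_combination (c : F) * hx

theorem card_radical_eq_pow {s l d : ℕ} (hF : Fintype.card F = p ^ (2 * s))
    (hs : d ∣ s) (hl : d ∣ l) (a b : F) : ∃ k, (radical p s l a b).card = p ^ (d * k) := by
  have h1 : Nat.card (fixedSubfield p d F) = p ^ d := by
    have h := card_filter_pow_prime_pow_eq hF d
    rw [Nat.gcd_eq_right (hs.mul_left 2), ← Fintype.card_subtype, ← Nat.card_eq_fintype_card] at h
    exact h
  have h2 := Module.natCard_eq_pow_finrank (K := fixedSubfield p d F)
    (V := radicalSubmodule p s l d hs hl a b)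
  rw [h1, ← pow_mul] at h2
  refine ⟨_, Eq.trans ?_ h2⟩
  rw [radical, ← Fintype.card_subtype, ← Nat.card_eq_fintype_card]
  rfl

omit [Fact p.Prime] [CharP F p] in
theorem card_filter_pow_eq_mul_le (k : ℕ) (γ : F) :
    (univ.filter fun u : F => u ^ p ^ k = γ * u).card
      ≤ (univ.filter fun u : F => u ^ p ^ k = u).card := by
  by_cases h : ∃ u₀ : F, u₀ ≠ 0 ∧ u₀ ^ p ^ k = γ * u₀
  · obtain ⟨u₀, h0, h1⟩ := h
    refine card_le_card_of_injOn (fun u => u / u₀) ?_ ?_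
    · intro u hu
      simp only [coe_filter, mem_univ, true_and, Set.mem_ofPred_eq] at hu ⊢
      have hγ : γ ≠ 0 := by
        rintro rfl
        rw [zero_mul] at h1
        exact pow_ne_zero _ h0 h1
      rw [div_pow, hu, h1, mul_div_mul_left _ _ hγ]
    · intro u _ v _ huv
      exact (div_left_inj' h0).mp huv
  · push Not at h
    refine (card_le_one.mpr ?_).trans (Nat.one_le_iff_ne_zero.mpr ?_)
    · intro u hu v hv
      simp only [mem_filter, mem_univ, true_and] at hu hv
      rw [not_imp_not.mp (h u) hu, not_imp_not.mp (h v) hv]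
    · refine (card_pos.mpr ⟨1, by simp⟩).ne'

theorem card_radical_le {s l d : ℕ} (hF : Fintype.card F = p ^ (2 * s))
    (hd' : (s + l).gcd (2 * l) = d) {a b : F} (hab : ¬ (a = 0 ∧ b = 0)) :
    (radical p s l a b).card ≤ p ^ (d * 2) := by
  have hpos : 1 ≤ p ^ (d * 2) := Nat.one_le_pow _ _ (Fact.out : p.Prime).pos
  have hfix : (univ.filter fun u : F => u ^ p ^ (s + l) = u).card = p ^ d := by
    rw [card_filter_pow_prime_pow_eq hF, Nat.gcd_comm, gcd_add_two_mul_left, hd']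
  by_cases h0 : ∃ x₀ ∈ radical p s l a b, x₀ ≠ 0
  swap
  · push Not at h0
    refine le_trans (card_le_one.mpr fun u hu v hv => ?_) hpos
    rw [h0 u hu, h0 v hv]
  obtain ⟨x₀, hx₀, hne⟩ := h0
  rw [mem_radical, polarPoly] at hx₀
  have hb : b ≠ 0 := by
    rintro rfl
    rw [zero_mul, zero_pow (pow_ne_zero _ (Fact.out : p.Prime).ne_zero), zero_mul, add_zero,
      add_zero] at hx₀
    exact hab ⟨eq_zero_of_pow_eq_zero ((mul_eq_zero.mp hx₀).resolve_right (pow_ne_zero _ hne)), rfl⟩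
  have htau : ∀ x : F, x ^ p ^ (2 * l) = (x ^ p ^ (s + l)) ^ p ^ (s + l) := by
    intro x
    rw [← pow_mul, ← pow_add, show s + l + (s + l) = 2 * s + 2 * l by ring, pow_add, pow_mul x,
      pow_prime_pow_of_card hF]
  have hB : b ^ p ^ l * x₀ ^ p ^ (2 * l) ≠ 0 := mul_ne_zero (pow_ne_zero _ hb) (pow_ne_zero _ hne)
  let f : F → F := fun x => (x / x₀) ^ p ^ (s + l) - x / x₀
  have himage : (radical p s l a b).image f
      ⊆ univ.filter fun u => u ^ p ^ (s + l) = b * x₀ / (b ^ p ^ l * x₀ ^ p ^ (2 * l)) * u := by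
    intro u hu
    obtain ⟨x, hx, rfl⟩ := mem_image.mp hu
    rw [mem_radical, polarPoly] at hx
    obtain ⟨t, rfl⟩ : ∃ t, x = x₀ * t := ⟨x / x₀, (mul_div_cancel₀ x hne).symm⟩
    simp only [mem_filter, mem_univ, true_and, f, mul_div_cancel_left₀ _ hne]
    rw [div_mul_eq_mul_div, eq_div_iff hB, sub_pow_char_pow, ← htau t]
    rw [mul_pow, mul_pow] at hx
    linear_combination hx - t ^ p ^ (s + l) * hx₀
  have hfib : ∀ u ∈ (radical p s l a b).image f,
      ((radical p s l a b).filter fun x => f x = u).card ≤ p ^ d := by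
    intro u hu
    obtain ⟨x, hx, rfl⟩ := mem_image.mp hu
    rw [← hfix]
    refine card_le_card_of_injOn (fun v => v / x₀ - x / x₀) ?_ ?_
    · intro v hv
      simp only [coe_filter, mem_univ, true_and, Set.mem_ofPred_eq, f] at hv ⊢
      rw [sub_pow_char_pow]
      linear_combination hv.2
    · intro v _ w _ h
      exact (div_left_inj' hne).mp (sub_left_inj.mp h)
  calc (radical p s l a b).card ≤ p ^ d * ((radical p s l a b).image f).card :=
        card_le_mul_card_image _ _ hfib
    _ ≤ p ^ d * p ^ d := Nat.mul_le_mul_left _ (((card_le_card himage).trans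
        (card_filter_pow_eq_mul_le _ _)).trans hfix.le)
    _ = p ^ (d * 2) := by rw [← pow_add, mul_two]

theorem exists_card_radical_eq {s l d : ℕ} (hF : Fintype.card F = p ^ (2 * s))
    (hd : s.gcd l = d) (hd' : (s + l).gcd (2 * l) = d) (hodd : Odd d) {a b : F}
    (hab : ¬ (a = 0 ∧ b = 0)) :
    ∃ k ≤ 2, (radical p s l a b).card = p ^ (d * k) := by
  obtain ⟨k, hk⟩ := card_radical_eq_pow hF (hd ▸ Nat.gcd_dvd_left s l) (hd ▸ Nat.gcd_dvd_right s l)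
    a b
  refine ⟨k, ?_, hk⟩
  have h := card_radical_le hF hd' hab
  rw [hk] at h
  exact Nat.le_of_mul_le_mul_left ((Nat.pow_le_pow_iff_right (Fact.out : p.Prime).one_lt).mp h)
    hodd.pos

end RadicalSize

section Structure

variable {p : ℕ} [Fact p.Prime] {F : Type*} [Field F] [Algebra (ZMod p) F] [CharP F p]

/-- `traceForm₂` as a quadratic form. -/
noncomputable def traceQuadraticForm (p s l : ℕ) [Fact p.Prime] {F : Type*} [Field F]
    [Algebra (ZMod p) F] [CharP F p] (a b : F) : QuadraticForm (ZMod p) F :=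
  LinearMap.BilinMap.toQuadraticMap (LinearMap.mk₂ (ZMod p)
    (fun x y => Algebra.trace (ZMod p) F (a / 2 * (x ^ p ^ s * y) + b * (x ^ p ^ l * y)))
    (fun x x' y => by
      rw [add_pow_char_pow, add_pow_char_pow, ← map_add]
      congr 1
      ring)
    (fun c x y => by
      rw [Algebra.smul_def, mul_pow, mul_pow, ← map_pow, ← map_pow, ZMod.pow_card_pow,
        ZMod.pow_card_pow, ← map_smul, Algebra.smul_def]
      congr 1
      ring)
    (fun x y y' => by
      rw [← map_add]
      congr 1
      ring)
    (fun c x y => by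
      rw [Algebra.smul_def, ← map_smul, Algebra.smul_def]
      congr 1
      ring))

theorem traceQuadraticForm_apply (s l : ℕ) (a b x : F) :
    traceQuadraticForm p s l a b x = traceForm₂ p s l a b x := by
  rw [traceForm₂, pow_succ, pow_succ]
  rfl

variable [Fintype F] [DecidableEq F]

omit [CharP F p] [DecidableEq F] in
theorem finrank_eq_of_card {n : ℕ} (hF : Fintype.card F = p ^ n) :
    Module.finrank (ZMod p) F = n := by
  have h := Module.card_eq_pow_finrank (K := ZMod p) (V := F)
  rw [hF, ZMod.card] at h
  exact (Nat.pow_right_injective (Fact.out : p.Prime).two_le h).symm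

/-- The exponential sum of `y` times the form `traceForm₂` plus the linear form of `c`. -/
noncomputable def affineExpSum (p s l : ℕ) [Fact p.Prime] {F : Type*} [Field F] [Fintype F]
    [Algebra (ZMod p) F] (y : ZMod p) (a b c : F) : ℂ :=
  ∑ x : F, (ZMod.stdAddChar
    (y * (traceForm₂ p s l a b x + Algebra.trace (ZMod p) F (c * x))) : ℂ)

theorem qchar_sq {y : ZMod p} (hy : y ≠ 0) : qchar p y * qchar p y = 1 := by
  rcases qchar_eq_one_or_neg_one hy with h | h <;> rw [h] <;> norm_num

theorem exists_expSum_eq (hp : p ≠ 2) {s : ℕ} (l : ℕ) (hF : Fintype.card F = p ^ (2 * s))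
    {a : F} (ha : a ^ p ^ s = a) (b : F) :
    ∃ r ≤ 2 * s, ∃ ε : ℂ, (ε = 1 ∨ ε = -1) ∧ (radical p s l a b).card = p ^ (2 * s - r) ∧
      (∀ y ≠ 0, expSum p s l y a b
        = (p : ℂ) ^ (2 * s - r) * qchar p y ^ r * ε * qgauss p ^ r) ∧
      ∀ c : F, (r ≠ 2 * s ∧ ∀ y ≠ 0, affineExpSum p s l y a b c = 0) ∨
        ∃ κ, ∀ y ≠ 0, affineExpSum p s l y a b c
          = expSum p s l y a b * ZMod.stdAddChar (-(y * κ)) := by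
  obtain ⟨r, hr, ε, hε, h1, h2⟩ :=
    QuadraticForm.exists_sum_stdAddChar_eval hp (traceQuadraticForm p s l a b)
  rw [finrank_eq_of_card hF] at hr h1 h2
  simp only [traceQuadraticForm_apply] at h1 h2
  have h1' : ∀ y ≠ 0, expSum p s l y a b
        = (p : ℂ) ^ (2 * s - r) * qchar p y ^ r * ε * qgauss p ^ r := h1
  refine ⟨r, hr, ε, hε, ?_, h1', fun c => ?_⟩
  · have h3 := expSum_mul_expSum_neg hp l hF ha b one_ne_zero
    rw [h1' 1 one_ne_zero, h1' (-1) (neg_ne_zero.mpr one_ne_zero), map_one, one_pow] at h3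
    have hp0 : (p : ℂ) ≠ 0 := Nat.cast_ne_zero.mpr (Fact.out : p.Prime).ne_zero
    have hε2 : ε * ε = 1 := by rcases hε with h | h <;> rw [h] <;> norm_num
    have hq : (qchar p (-1) * qgauss p ^ 2) ^ r = (p : ℂ) ^ r := by
      rw [qgauss_sq hp, ← mul_assoc, qchar_sq (neg_ne_zero.mpr one_ne_zero), one_mul]
    have hpp : (p : ℂ) ^ (2 * s - r) * (p : ℂ) ^ r = (p : ℂ) ^ (2 * s) := by
      rw [← pow_add, Nat.sub_add_cancel hr]
    have h4 : (p : ℂ) ^ (2 * s) * (radical p s l a b).card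
        = (p : ℂ) ^ (2 * s) * (p : ℂ) ^ (2 * s - r) := by
      calc (p : ℂ) ^ (2 * s) * (radical p s l a b).card
          = (p : ℂ) ^ (2 * s - r) * (p : ℂ) ^ (2 * s - r) * (ε * ε)
            * (qchar p (-1) * qgauss p ^ 2) ^ r := by rw [← h3]; ring
        _ = ((p : ℂ) ^ (2 * s - r) * (p : ℂ) ^ r) * (p : ℂ) ^ (2 * s - r) := by
            rw [hε2, hq]; ring
        _ = _ := by rw [hpp]
    have h5 := mul_left_cancel₀ (pow_ne_zero _ hp0) h4
    exact_mod_cast h5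
  · have h3 := h2 ((Algebra.trace (ZMod p) F).comp (LinearMap.mulLeft (ZMod p) c))
    rcases h3 with ⟨hn, h3⟩ | ⟨κ, h3⟩
    · exact Or.inl ⟨hn, h3⟩
    · refine Or.inr ⟨κ, fun y hy => ?_⟩
      rw [h1' y hy]
      exact h3 y hy

end Structure

section Classification

variable {p : ℕ} [Fact p.Prime] {F : Type*} [Field F] [Algebra (ZMod p) F] [CharP F p]
  [Fintype F] [DecidableEq F]

theorem expSum_cases (hp : p ≠ 2) {s l d : ℕ} (hF : Fintype.card F = p ^ (2 * s))
    (hd : s.gcd l = d) (hd' : (s + l).gcd (2 * l) = d) (hodd : Odd d) {a b : F}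
    (ha : a ^ p ^ s = a) (hab : ¬ (a = 0 ∧ b = 0)) :
    (∃ j ≤ 1, ∃ δ : ℂ, (δ = 1 ∨ δ = -1) ∧ (radical p s l a b).card = p ^ (2 * d * j) ∧
        ∀ y ≠ 0, expSum p s l y a b = δ * (p : ℂ) ^ (s + d * j)) ∨
      ∃ τ : ℂ, (radical p s l a b).card = p ^ d ∧ τ ^ 2 = qchar p (-1) * (p : ℂ) ^ (2 * s + d) ∧
        ∀ y ≠ 0, expSum p s l y a b = qchar p y * τ := by
  obtain ⟨r, hr, ε, hε, hK, hT, -⟩ := exists_expSum_eq hp l hF ha b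
  obtain ⟨k, hk, hK'⟩ := exists_card_radical_eq hF hd hd' hodd hab
  have hrk : 2 * s - r = d * k :=
    Nat.pow_right_injective (Fact.out : p.Prime).two_le (hK.symm.trans hK')
  have hε2 : ε ^ 2 = 1 := by rcases hε with h | h <;> rw [h] <;> norm_num
  have hm1 : (-1 : ZMod p) ≠ 0 := neg_ne_zero.mpr one_ne_zero
  have heven : ∀ j ≤ 1, k = 2 * j → (∃ j ≤ 1, ∃ δ : ℂ, (δ = 1 ∨ δ = -1) ∧
      (radical p s l a b).card = p ^ (2 * d * j) ∧
        ∀ y ≠ 0, expSum p s l y a b = δ * (p : ℂ) ^ (s + d * j)) := by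
    intro j hj hkj
    have hrj : 2 * s - r = 2 * (d * j) := by rw [hrk, hkj]; ring
    obtain ⟨i, hi, hij⟩ : ∃ i, r = 2 * i ∧ i + d * j = s := ⟨s - d * j, by omega, by omega⟩
    refine ⟨j, hj, ε * qchar p (-1) ^ i, ?_, by rw [hK', hkj]; ring_nf, fun y hy => ?_⟩
    · have h1 : (ε * qchar p (-1) ^ i) * (ε * qchar p (-1) ^ i) = 1 := by
        calc _ = ε ^ 2 * (qchar p (-1) * qchar p (-1)) ^ i := by ring
          _ = 1 := by rw [hε2, qchar_sq hm1, one_pow, one_mul]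
      exact mul_self_eq_one_iff.mp h1
    · rw [hT y hy, hrj, hi, pow_mul (qchar p y), pow_two, qchar_sq hy, one_pow, pow_mul (qgauss p),
        qgauss_sq hp, ← hij]
      ring
  interval_cases k
  · exact Or.inl (heven 0 zero_le_one rfl)
  · right
    rw [mul_one] at hrk hK'
    have hrodd : Odd r := by
      obtain ⟨e, he⟩ := hodd
      exact ⟨s - e - 1, by omega⟩
    have hrd : r + d = 2 * s := by omega
    refine ⟨(p : ℂ) ^ d * ε * qgauss p ^ r, hK', ?_, fun y hy => ?_⟩
    · have h1 : ((p : ℂ) ^ d * ε * qgauss p ^ r) ^ 2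
          = (p : ℂ) ^ (d + d) * ε ^ 2 * (qgauss p ^ 2) ^ r := by ring
      rw [h1, hε2, qgauss_sq hp, mul_pow]
      have h2 : qchar p (-1) ^ r = qchar p (-1) := by
        rcases qchar_eq_one_or_neg_one hm1 with h | h <;> rw [h]
        · exact one_pow _
        · exact hrodd.neg_one_pow
      rw [h2, ← hrd]
      ring
    · have h2 : qchar p y ^ r = qchar p y := by
        rcases qchar_eq_one_or_neg_one hy with h | h <;> rw [h]
        · exact one_pow _
        · exact hrodd.neg_one_pow
      rw [hT y hy, hrk, h2]
      ring
  · exact Or.inl (heven 1 le_rfl rfl)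

theorem affineExpSum_cases (hp : p ≠ 2) {s : ℕ} (l : ℕ) (hF : Fintype.card F = p ^ (2 * s))
    {a : F} (ha : a ^ p ^ s = a) (b c : F) :
    ((radical p s l a b).card ≠ 1 ∧ ∀ y ≠ 0, affineExpSum p s l y a b c = 0) ∨
        ∃ κ, ∀ y ≠ 0, affineExpSum p s l y a b c
          = expSum p s l y a b * ZMod.stdAddChar (-(y * κ)) := by
  obtain ⟨r, hr, ε, hε, hK, hT, h⟩ := exists_expSum_eq hp l hF ha b
  refine (h c).imp_left (And.imp_left fun hn => ?_)
  rw [hK]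
  exact (Nat.one_lt_pow (by omega) (Fact.out : p.Prime).one_lt).ne'

theorem sum_erase_stdAddChar_mul (t : ZMod p) :
    ∑ y ∈ univ.erase (0 : ZMod p), (ZMod.stdAddChar (y * t) : ℂ)
      = (if t = 0 then (p : ℂ) else 0) - 1 := by
  have h := add_sum_erase univ (fun y : ZMod p => (ZMod.stdAddChar (y * t) : ℂ)) (mem_univ 0)
  simp only [zero_mul, AddChar.map_zero_eq_one, sum_stdAddChar_mul] at h
  rw [← h]
  ring

theorem sum_erase_qchar_mul_stdAddChar (hp : p ≠ 2) (t : ZMod p) :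
    ∑ y ∈ univ.erase (0 : ZMod p), qchar p y * (ZMod.stdAddChar (y * t) : ℂ)
      = qchar p t * qgauss p := by
  rw [← sum_qchar_mul_stdAddChar hp t, ← add_sum_erase univ _ (mem_univ (0 : ZMod p)),
    MulChar.map_nonunit _ not_isUnit_zero, zero_mul, zero_add]
  exact sum_congr rfl fun y _ => by rw [mul_comm t]

/-- The set of zeros of `traceForm₂` plus the affine form given by `c` and `h`. -/
noncomputable def affineZeros (p s l : ℕ) [Fact p.Prime] {F : Type*} [Field F] [Fintype F]
    [Algebra (ZMod p) F] (a b c : F) (h : ZMod p) : Finset F :=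
  univ.filter fun x => traceForm₂ p s l a b x + Algebra.trace (ZMod p) F (c * x) + h = 0

omit [CharP F p] [DecidableEq F] in
theorem card_affineZeros {n : ℕ} (hF : Fintype.card F = p ^ n) (s l : ℕ) (a b c : F) (h : ZMod p) :
    (p : ℂ) * (affineZeros p s l a b c h).card = (p : ℂ) ^ n
      + ∑ y ∈ univ.erase (0 : ZMod p), affineExpSum p s l y a b c * ZMod.stdAddChar (y * h) := by
  have h1 : (p : ℂ) * (affineZeros p s l a b c h).card
      = ∑ y : ZMod p, affineExpSum p s l y a b c * ZMod.stdAddChar (y * h) := by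
    simp only [affineExpSum, sum_mul]
    rw [sum_comm]
    have h2 : ∀ x : F, ∑ y : ZMod p, (ZMod.stdAddChar
        (y * (traceForm₂ p s l a b x + Algebra.trace (ZMod p) F (c * x))) : ℂ)
          * ZMod.stdAddChar (y * h)
        = if traceForm₂ p s l a b x + Algebra.trace (ZMod p) F (c * x) + h = 0
          then (p : ℂ) else 0 := by
      intro x
      rw [← sum_stdAddChar_mul]
      refine sum_congr rfl fun y _ => ?_
      rw [← AddChar.map_add_eq_mul, ← mul_add]
    simp only [h2]
    rw [← sum_filter, sum_const, nsmul_eq_mul, mul_comm, affineZeros]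
  rw [h1, ← add_sum_erase univ _ (mem_univ (0 : ZMod p))]
  congr 1
  simp [affineExpSum, hF]

/-- The exceptional sum giving the weight `(p - 1) * (p ^ (2 * s - 1) + p ^ (s - 1))`. -/
theorem sum_affineExpSum_eq_iff (hp : p ≠ 2) {s l d : ℕ} (hF : Fintype.card F = p ^ (2 * s))
    (hd : s.gcd l = d) (hd' : (s + l).gcd (2 * l) = d) (hodd : Odd d) {a b : F}
    (ha : a ^ p ^ s = a) (hab : ¬ (a = 0 ∧ b = 0)) (c : F) :
    (¬ ((radical p s l a b).card = 1 ∧ expSum p s l 1 a b = -(p : ℂ) ^ s) ∧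
      ∀ h, ∑ y ∈ univ.erase (0 : ZMod p), affineExpSum p s l y a b c * ZMod.stdAddChar (y * h)
        ≠ -(((p : ℂ) - 1) * (p : ℂ) ^ s)) ∨
    (((radical p s l a b).card = 1 ∧ expSum p s l 1 a b = -(p : ℂ) ^ s) ∧
      ∃ κ, ∀ h, ∑ y ∈ univ.erase (0 : ZMod p),
        affineExpSum p s l y a b c * ZMod.stdAddChar (y * h)
        = -(((p : ℂ) - 1) * (p : ℂ) ^ s) ↔ h = κ) := by
  have hpp := (Fact.out : p.Prime)
  have hp0 : (p : ℂ) ≠ 0 := Nat.cast_ne_zero.mpr hpp.ne_zero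
  have hP0 : (p : ℂ) ^ s ≠ 0 := pow_ne_zero _ hp0
  have hp1 : (p : ℂ) - 1 ≠ 0 := sub_ne_zero.mpr (by exact_mod_cast hpp.one_lt.ne')
  have hp2 : (p : ℂ) ≠ 2 := by exact_mod_cast hp
  have hp3 : 3 ≤ p := by have := hpp.two_le; omega
  rcases affineExpSum_cases hp l hF ha b c with ⟨hK, h0⟩ | ⟨κ, hκ⟩
  · refine Or.inl ⟨fun h => hK h.1, fun h => ?_⟩
    rw [sum_congr rfl fun y hy => by rw [h0 y (mem_erase.mp hy).1, zero_mul], sum_const_zero]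
    exact (neg_ne_zero.mpr (mul_ne_zero hp1 hP0)).symm
  have hsum : ∀ h, ∑ y ∈ univ.erase (0 : ZMod p),
      affineExpSum p s l y a b c * (ZMod.stdAddChar (y * h) : ℂ)
      = ∑ y ∈ univ.erase (0 : ZMod p),
        expSum p s l y a b * (ZMod.stdAddChar (y * (h - κ)) : ℂ) := by
    intro h
    refine sum_congr rfl fun y hy => ?_
    rw [hκ y (mem_erase.mp hy).1, mul_assoc, ← AddChar.map_add_eq_mul]
    congr 2
    ring
  simp only [hsum]
  rcases expSum_cases hp hF hd hd' hodd ha hab with ⟨j, hj, δ, hδ, hK, hT⟩ | ⟨τ, hK, hτ, hT⟩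
  · have hsum' : ∀ h, ∑ y ∈ univ.erase (0 : ZMod p),
        expSum p s l y a b * (ZMod.stdAddChar (y * (h - κ)) : ℂ)
        = δ * (p : ℂ) ^ (s + d * j) * ((if h = κ then (p : ℂ) else 0) - 1) := by
      intro h
      rw [sum_congr rfl fun y hy => by rw [hT y (mem_erase.mp hy).1], ← mul_sum,
        sum_erase_stdAddChar_mul]
      simp only [sub_eq_zero]
    simp only [hsum']
    interval_cases j
    · have hK1 : (radical p s l a b).card = 1 := by rw [hK, mul_zero, pow_zero]
      rw [hT 1 one_ne_zero]
      simp only [mul_zero, add_zero]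
      rcases hδ with rfl | rfl
      · left
        have h1 : (p : ℂ) ^ s ≠ -(p : ℂ) ^ s := by
          intro h
          have : 2 * (p : ℂ) ^ s = 0 := by linear_combination h
          exact (mul_ne_zero two_ne_zero hP0) this
        refine ⟨fun h => h1 (by rw [← h.2, one_mul]), fun h h2 => ?_⟩
        split_ifs at h2
        · have h3 : (p : ℂ) ^ s * (2 * ((p : ℂ) - 1)) = 0 := by linear_combination h2
          exact mul_ne_zero hP0 (mul_ne_zero two_ne_zero hp1) h3
        · have h3 : (p : ℂ) ^ s * ((p : ℂ) - 2) = 0 := by linear_combination h2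
          exact mul_ne_zero hP0 (sub_ne_zero.mpr hp2) h3
      · right
        refine ⟨⟨hK1, by ring⟩, κ, fun h => ?_⟩
        split_ifs with h2
        · simp only [h2, iff_true]
          ring
        · simp only [h2, iff_false]
          intro h3
          have h4 : (p : ℂ) ^ s * (p : ℂ) = 0 := by linear_combination h3
          exact mul_ne_zero hP0 hp0 h4
    · left
      rw [mul_one] at hK ⊢
      have hDp : p ≤ p ^ d := Nat.le_self_pow hodd.pos.ne' p
      refine ⟨fun h => ?_, fun h h2 => ?_⟩
      · have := h.1
        rw [hK] at this
        exact (Nat.one_lt_pow (by have := hodd.pos; omega) hpp.one_lt).ne' this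
      · rw [pow_add] at h2
        have h3 : δ * ((p ^ d : ℕ) : ℂ) * ((if h = κ then (p : ℂ) else 0) - 1)
            = -((p : ℂ) - 1) := by
          refine mul_left_cancel₀ hP0 ?_
          push_cast
          linear_combination h2
        generalize p ^ d = D at h3 hDp
        have hDp' : (p : ℤ) ≤ D := by exact_mod_cast hDp
        have hp3' : (3 : ℤ) ≤ p := by exact_mod_cast hp3
        rcases hδ with rfl | rfl <;> split_ifs at h3
        · have h4 : (1 * D * (p - 1) : ℤ) = -(p - 1) := by exact_mod_cast h3
          nlinarith
        · have h4 : (1 * D * (0 - 1) : ℤ) = -(p - 1) := by exact_mod_cast h3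
          nlinarith
        · have h4 : (-1 * D * (p - 1) : ℤ) = -(p - 1) := by exact_mod_cast h3
          nlinarith
        · have h4 : (-1 * D * (0 - 1) : ℤ) = -(p - 1) := by exact_mod_cast h3
          nlinarith
  · left
    have hDp : p ≤ p ^ d := Nat.le_self_pow hodd.pos.ne' p
    refine ⟨fun h => ?_, fun h h2 => ?_⟩
    · have := h.1
      rw [hK] at this
      exact (Nat.one_lt_pow (by have := hodd.pos; omega) hpp.one_lt).ne' this
    · rw [sum_congr rfl fun y hy => by rw [hT y (mem_erase.mp hy).1, mul_right_comm, mul_comm],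
        ← mul_sum, sum_erase_qchar_mul_stdAddChar hp] at h2
      have h3 : ((p ^ d : ℕ) : ℂ) * p * (qchar p (h - κ)) ^ 2 = ((p : ℂ) - 1) ^ 2 := by
        refine mul_left_cancel₀ (pow_ne_zero 2 hP0) ?_
        have hm := qchar_sq (neg_ne_zero.mpr (one_ne_zero (α := ZMod p)))
        calc ((p : ℂ) ^ s) ^ 2 * (((p ^ d : ℕ) : ℂ) * p * (qchar p (h - κ)) ^ 2)
            = (qchar p (-1) * qchar p (-1)) * (p : ℂ) ^ (2 * s + d) * p
              * (qchar p (h - κ)) ^ 2 := by rw [hm]; push_cast; ring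
          _ = (τ * (qchar p (h - κ) * qgauss p)) ^ 2 := by
              rw [mul_pow, mul_pow, hτ, qgauss_sq hp]; ring
          _ = _ := by rw [h2]; ring
      by_cases h5 : h - κ = 0
      · rw [h5, MulChar.map_nonunit _ not_isUnit_zero] at h3
        exact pow_ne_zero 2 hp1 (by rw [← h3]; ring)
      · rw [pow_two, qchar_sq h5, mul_one] at h3
        generalize p ^ d = D at h3 hDp
        have hDp' : (p : ℤ) ≤ D := by exact_mod_cast hDp
        have hp3' : (3 : ℤ) ≤ p := by exact_mod_cast hp3
        have h4 : (D * p : ℤ) = (p - 1) ^ 2 := by exact_mod_cast h3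
        nlinarith

omit [CharP F p] in
theorem sum_affineExpSum_zero_ne {s : ℕ} (hs : s ≠ 0) (l : ℕ)
    (hF : Fintype.card F = p ^ (2 * s)) (c : F) (h : ZMod p) :
    ∑ y ∈ univ.erase (0 : ZMod p), affineExpSum p s l y 0 0 c * ZMod.stdAddChar (y * h)
        ≠ -(((p : ℂ) - 1) * (p : ℂ) ^ s) := by
  have hpp := (Fact.out : p.Prime)
  have hp0 : (p : ℂ) ≠ 0 := Nat.cast_ne_zero.mpr hpp.ne_zero
  have hP0 : (p : ℂ) ^ s ≠ 0 := pow_ne_zero _ hp0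
  have hp1 : (p : ℂ) - 1 ≠ 0 := sub_ne_zero.mpr (by exact_mod_cast hpp.one_lt.ne')
  have h1 : ∀ y ≠ 0, affineExpSum p s l y (0 : F) 0 c = if c = 0 then (p : ℂ) ^ (2 * s) else 0 := by
    intro y hy
    have := sum_stdAddChar_mul_trace hy c
    rw [hF] at this
    push_cast at this
    rw [← this, affineExpSum]
    simp [traceForm₂, mul_comm c]
  rw [sum_congr rfl fun y hy => by rw [h1 y (mem_erase.mp hy).1], ← mul_sum,
    sum_erase_stdAddChar_mul]
  have hPp : p ≤ p ^ s := Nat.le_self_pow hs p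
  intro h2
  split_ifs at h2
  · have h3 : (p : ℂ) ^ s * ((p ^ s + 1 : ℕ) : ℂ) * (p - 1) = 0 := by
      push_cast
      linear_combination h2
    exact mul_ne_zero (mul_ne_zero hP0 (Nat.cast_ne_zero.mpr (Nat.succ_ne_zero _))) hp1 h3
  · have h3 : ((p ^ s : ℕ) : ℂ) = (p : ℂ) - 1 := by
      refine mul_left_cancel₀ hP0 ?_
      push_cast
      linear_combination -h2
    generalize p ^ s = P at h3 hPp
    have h4 : (P : ℤ) = p - 1 := by exact_mod_cast h3
    omega
  · exact mul_ne_zero hp1 hP0 (by linear_combination h2)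
  · exact mul_ne_zero hp1 hP0 (by linear_combination h2)

end Classification

section Count

variable {p : ℕ} [Fact p.Prime] {F : Type*} [Field F] [Algebra (ZMod p) F] [CharP F p]
  [Fintype F] [DecidableEq F]

omit [CharP F p] [DecidableEq F] in
theorem expSum_zero {s l : ℕ} (hF : Fintype.card F = p ^ (2 * s)) (y : ZMod p) :
    expSum p s l y (0 : F) 0 = (p : ℂ) ^ (2 * s) := by
  simp [expSum, traceForm₂, hF]

omit [Algebra (ZMod p) F] [CharP F p] in
theorem card_radical_zero {s l : ℕ} (hF : Fintype.card F = p ^ (2 * s)) :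
    (radical p s l (0 : F) 0).card = p ^ (2 * s) := by
  rw [← hF, radical, filter_true_of_mem, card_univ]
  intro x _
  simp [polarPoly, (Fact.out : p.Prime).ne_zero]

open scoped Classical in
/-- An indicator function as a combination of functions with known sums. -/
theorem indicator_expSum_eq (hp : p ≠ 2) {s l d : ℕ} (hF : Fintype.card F = p ^ (2 * s))
    (hd : s.gcd l = d) (hd' : (s + l).gcd (2 * l) = d) (hodd : Odd d) {ν : ZMod p} (hν0 : ν ≠ 0)
    (hν : qchar p ν = -1) {a b : F} (ha : a ^ p ^ s = a) (hab : ¬ (a = 0 ∧ b = 0)) :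
    4 * (p : ℂ) ^ (2 * s) * ((p : ℂ) ^ (2 * d) - 1) *
        (if (radical p s l a b).card = 1 ∧ expSum p s l 1 a b = -(p : ℂ) ^ s then 1 else 0)
      = 2 * (p : ℂ) ^ (2 * s) * (p : ℂ) ^ (2 * d)
        - (1 + (p : ℂ) ^ d) * (p : ℂ) ^ (2 * s) * (radical p s l a b).card
        - (1 - (p : ℂ) ^ d) * (expSum p s l 1 a b * expSum p s l (-ν) a b)
        - (p : ℂ) ^ s * (expSum p s l 1 a b + expSum p s l ν a b)
          * ((p : ℂ) ^ (2 * d) - (radical p s l a b).card) := by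
  have hpp := (Fact.out : p.Prime)
  have hp0 : (p : ℂ) ≠ 0 := Nat.cast_ne_zero.mpr hpp.ne_zero
  have hP0 : (p : ℂ) ^ s ≠ 0 := pow_ne_zero _ hp0
  rcases expSum_cases hp hF hd hd' hodd ha hab with ⟨j, hj, δ, hδ, hK, hT⟩ | ⟨τ, hK, hτ, hT⟩
  · rw [hT 1 one_ne_zero, hT ν hν0, hT (-ν) (neg_ne_zero.mpr hν0), hK]
    interval_cases j
    · simp only [mul_zero, pow_zero, add_zero, true_and]
      rcases hδ with rfl | rfl
      · have h1 : 1 * (p : ℂ) ^ s ≠ -(p : ℂ) ^ s := by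
          intro h
          have : 2 * (p : ℂ) ^ s = 0 := by linear_combination h
          exact (mul_ne_zero two_ne_zero hP0) this
        rw [if_neg h1]
        push_cast
        ring
      · rw [if_pos (by ring)]
        push_cast
        ring
    · have h1 : p ^ (2 * d * 1) ≠ 1 :=
        (Nat.one_lt_pow (by have := hodd.pos; omega) hpp.one_lt).ne'
      rw [if_neg (fun h => h1 h.1)]
      push_cast
      rcases hδ with rfl | rfl <;> ring
  · have h1 : p ^ d ≠ 1 := (Nat.one_lt_pow hodd.pos.ne' hpp.one_lt).ne'
    rw [hT 1 one_ne_zero, hT ν hν0, hT (-ν) (neg_ne_zero.mpr hν0), hK, if_neg (fun h => h1 h.1),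
      hν, map_one, ← neg_one_mul ν, map_mul, hν]
    have hm := qchar_sq (neg_ne_zero.mpr (one_ne_zero (α := ZMod p)))
    push_cast
    linear_combination -(1 - (p : ℂ) ^ d) * qchar p (-1) * hτ
      - (1 - (p : ℂ) ^ d) * (p : ℂ) ^ (2 * s + d) * hm

open scoped Classical in
theorem sum_indicator_expSum (hp : p ≠ 2) {s l d : ℕ} (hs : s ≠ 0) (hl : l ≤ 2 * s)
    (hF : Fintype.card F = p ^ (2 * s))
    (hd : s.gcd l = d) (hd' : (s + l).gcd (2 * l) = d) (hodd : Odd d) :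
    2 * ((p : ℂ) ^ d - 1) * ∑ a ∈ fixedFinset p s F, ∑ b : F,
        (if (radical p s l a b).card = 1 ∧ expSum p s l 1 a b = -(p : ℂ) ^ s then 1 else 0)
      = ((p : ℂ) ^ d * (p : ℂ) ^ (2 * s) - 2 * (p : ℂ) ^ (2 * s) + (p : ℂ) ^ d)
        * ((p : ℂ) ^ s - 1) := by
  have hpp := (Fact.out : p.Prime)
  have hp0 : (p : ℂ) ≠ 0 := Nat.cast_ne_zero.mpr hpp.ne_zero
  have hP0 : (p : ℂ) ^ s ≠ 0 := pow_ne_zero _ hp0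
  obtain ⟨ν, hν⟩ := FiniteField.exists_nonsquare (F := ZMod p) (by rwa [ZMod.ringChar_zmod_n])
  have hν0 : ν ≠ 0 := by rintro rfl; exact hν IsSquare.zero
  have hνq : qchar p ν = -1 := by
    rw [qchar, MulChar.ringHomComp_apply, quadraticChar_neg_one_iff_not_isSquare.mpr hν]
    simp
  set f : F → F → ℂ := fun a b => 2 * (p : ℂ) ^ (2 * s) * (p : ℂ) ^ (2 * d)
        - (1 + (p : ℂ) ^ d) * (p : ℂ) ^ (2 * s) * (radical p s l a b).card
        - (1 - (p : ℂ) ^ d) * (expSum p s l 1 a b * expSum p s l (-ν) a b)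
        - (p : ℂ) ^ s * (expSum p s l 1 a b + expSum p s l ν a b)
          * ((p : ℂ) ^ (2 * d) - (radical p s l a b).card) with hf
  set g : F → F → ℂ := fun a b =>
    if (radical p s l a b).card = 1 ∧ expSum p s l 1 a b = -(p : ℂ) ^ s then 1 else 0 with hg
  have hg0 : g 0 0 = 0 := by
    simp only [hg, card_radical_zero hF]
    exact if_neg fun h => (Nat.one_lt_pow (by omega) hpp.one_lt).ne' h.1
  have h0 : (0 : F) ∈ fixedFinset p s F := by simp [mem_fixedFinset, hpp.ne_zero]
  have h1 : 4 * (p : ℂ) ^ (2 * s) * ((p : ℂ) ^ (2 * d) - 1) * ∑ a ∈ fixedFinset p s F, ∑ b : F, g a b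
      = ∑ a ∈ fixedFinset p s F, ∑ b : F, f a b - f 0 0 := by
    have h2 : ∀ k : F → F → ℂ, ∑ a ∈ fixedFinset p s F, ∑ b : F, k a b
        = k 0 0 + ∑ t ∈ (fixedFinset p s F ×ˢ univ).erase (0, 0), k t.1 t.2 := by
      intro k
      rw [← sum_product', ← add_sum_erase _ _
        (show ((0 : F), (0 : F)) ∈ fixedFinset p s F ×ˢ univ from
          mem_product.mpr ⟨h0, mem_univ (0 : F)⟩)]
    rw [h2 g, h2 f, hg0, zero_add, add_sub_cancel_left, mul_sum]
    refine sum_congr rfl fun t ht => ?_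
    obtain ⟨ht0, ht1⟩ := mem_erase.mp ht
    exact indicator_expSum_eq hp hF hd hd' hodd hν0 hνq
      (mem_fixedFinset.mp (mem_product.mp ht1).1) fun h => ht0 (Prod.ext h.1 h.2)
  have h3 : ∑ a ∈ fixedFinset p s F, ∑ b : F, f a b
      = 2 * (p : ℂ) ^ (2 * s) * (p : ℂ) ^ (2 * d) * (p : ℂ) ^ (3 * s)
        - (1 + (p : ℂ) ^ d) * (p : ℂ) ^ (2 * s)
          * ((p : ℂ) ^ (3 * s) + ((p : ℂ) ^ (2 * s) - 1) * (p : ℂ) ^ s)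
        - (1 - (p : ℂ) ^ d) * (p : ℂ) ^ (3 * s)
        - ((p : ℂ) ^ s * (p : ℂ) ^ (2 * d) * (p : ℂ) ^ (3 * s)
          + (p : ℂ) ^ s * (p : ℂ) ^ (2 * d) * (p : ℂ) ^ (3 * s)
          - (p : ℂ) ^ s * ((p : ℂ) ^ (3 * s) + ((p : ℂ) ^ (2 * s) - 1) * (p : ℂ) ^ (s + d))
          - (p : ℂ) ^ s * ((p : ℂ) ^ (3 * s) + ((p : ℂ) ^ (2 * s) - 1) * (p : ℂ) ^ (s + d))) := by
    have h4 : ∀ a b, f a b = 2 * (p : ℂ) ^ (2 * s) * (p : ℂ) ^ (2 * d)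
        - (1 + (p : ℂ) ^ d) * (p : ℂ) ^ (2 * s) * (radical p s l a b).card
        - (1 - (p : ℂ) ^ d) * (expSum p s l 1 a b * expSum p s l (-ν) a b)
        - ((p : ℂ) ^ s * (p : ℂ) ^ (2 * d) * expSum p s l 1 a b
          + (p : ℂ) ^ s * (p : ℂ) ^ (2 * d) * expSum p s l ν a b
          - (p : ℂ) ^ s * (expSum p s l 1 a b * (radical p s l a b).card)
          - (p : ℂ) ^ s * (expSum p s l ν a b * (radical p s l a b).card)) := by
      intro a b
      simp only [hf]
      ring
    simp only [h4, sum_sub_distrib, sum_add_distrib, ← mul_sum]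
    rw [sum_card_radical hp hl hF hd hd', sum_expSum_mul_expSum hp hF hd hd' hodd hν,
      sum_expSum hp l hF one_ne_zero, sum_expSum hp l hF hν0,
      sum_expSum_mul_card_radical hp hl hF hd hd' one_ne_zero,
      sum_expSum_mul_card_radical hp hl hF hd hd' hν0]
    congr 3
    rw [sum_const, sum_const, card_fixedFinset hF, card_univ, hF, nsmul_eq_mul, nsmul_eq_mul]
    push_cast
    ring
  have h5 : f 0 0 = 2 * (p : ℂ) ^ (2 * s) * ((p : ℂ) ^ (2 * d) - (p : ℂ) ^ (2 * s)
      - (p : ℂ) ^ s * (p : ℂ) ^ (2 * d) + (p : ℂ) ^ (3 * s)) := by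
    simp only [hf, expSum_zero hF, card_radical_zero hF]
    push_cast
    ring
  have hD1 : (p : ℂ) ^ d + 1 ≠ 0 := by exact_mod_cast Nat.succ_ne_zero (p ^ d)
  refine mul_left_cancel₀ (mul_ne_zero (mul_ne_zero two_ne_zero (pow_ne_zero (2 * s) hp0)) hD1) ?_
  rw [h3, h5] at h1
  linear_combination h1

end Count

section Codewords

variable {p : ℕ} [Fact p.Prime] {F : Type} [Field F] [Algebra (ZMod p) F] [CharP F p]
  [Fintype F]

omit [CharP F p] in
theorem trp_eq_algebraMap_trace {n : ℕ} (hF : Fintype.card F = p ^ n) (z : F) :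
    trp p n z = algebraMap (ZMod p) F (Algebra.trace (ZMod p) F z) := by
  rw [FiniteField.algebraMap_trace_eq_sum_pow, finrank_eq_of_card hF, Nat.card_zmod]
  rfl

theorem trp_eq_algebraMap_trace_half (hp : p ≠ 2) {s : ℕ} (hF : Fintype.card F = p ^ (2 * s))
    {z : F} (hz : z ^ p ^ s = z) :
    trp p s z = algebraMap (ZMod p) F (Algebra.trace (ZMod p) F (z / 2)) := by
  have h2 := two_ne_zero_of_algebra p F hp
  rw [← trp_eq_algebraMap_trace hF, trp, trp, two_mul, sum_range_add, ← sum_add_distrib]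
  refine sum_congr rfl fun i _ => ?_
  rw [pow_add, pow_mul (z / 2), div_pow z 2 (p ^ s), hz, two_pow_prime_pow, div_pow,
    two_pow_prime_pow]
  field_simp
  ring

theorem cword_eq (hp : p ≠ 2) {s : ℕ} (l : ℕ) (hF : Fintype.card F = p ^ (2 * s)) {a : F}
    (ha : a ^ p ^ s = a) (b c : F) (h : ZMod p) (x : F) :
    cword p s l a b c h x = algebraMap (ZMod p) F
      (traceForm₂ p s l a b x + Algebra.trace (ZMod p) F (c * x) + h) := by
  have h1 : (ZMod.cast h : F) = algebraMap (ZMod p) F h := by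
    rw [← ZMod.castHom_apply (h := dvd_refl p) h]
    exact RingHom.congr_fun (Subsingleton.elim _ _) h
  have h2 : traceForm₂ p s l a b x = Algebra.trace (ZMod p) F (a * x ^ (p ^ s + 1) / 2)
      + Algebra.trace (ZMod p) F (b * x ^ (p ^ l + 1)) := by
    rw [traceForm₂, ← map_add]
    congr 1
    ring
  rw [cword, trp_eq_algebraMap_trace hF, trp_eq_algebraMap_trace_half hp hF (by
    rw [mul_pow, ha, norm_pow_prime_pow hF]), h1, h2]
  simp only [map_add]
  ring

variable [DecidableEq F]

theorem card_suppw_eq_iff (hp : p ≠ 2) {s : ℕ} (hs : s ≠ 0) (l : ℕ)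
    (hF : Fintype.card F = p ^ (2 * s)) {a : F}
    (ha : a ^ p ^ s = a) (b c : F) (h : ZMod p) :
    (suppw p s l a b c h).card = (p - 1) * (p ^ (2 * s - 1) + p ^ (s - 1)) ↔
      ∑ y ∈ univ.erase (0 : ZMod p), affineExpSum p s l y a b c * ZMod.stdAddChar (y * h)
        = -(((p : ℂ) - 1) * (p : ℂ) ^ s) := by
  have hpp := (Fact.out : p.Prime)
  have hp0 : (p : ℂ) ≠ 0 := Nat.cast_ne_zero.mpr hpp.ne_zero
  have h1 : (suppw p s l a b c h).card + (affineZeros p s l a b c h).card = p ^ (2 * s) := by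
    rw [← hF, ← card_univ, add_comm, suppw, affineZeros]
    rw [← card_filter_add_card_filter_not (s := univ) (p := fun x : F =>
      traceForm₂ p s l a b x + Algebra.trace (ZMod p) F (c * x) + h = 0)]
    congr 2
    refine filter_congr fun x _ => ?_
    rw [cword_eq hp l hF ha, Ne, map_eq_zero]
  have h2 := card_affineZeros hF s l a b c h
  have h3 : ((suppw p s l a b c h).card : ℂ) + (affineZeros p s l a b c h).card
      = (p : ℂ) ^ (2 * s) := by exact_mod_cast h1
  have e1 : (p : ℂ) ^ (2 * s) = (p : ℂ) ^ (2 * s - 1) * p := by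
    rw [← pow_succ, Nat.sub_add_cancel (by omega)]
  have e2 : (p : ℂ) ^ s = (p : ℂ) ^ (s - 1) * p := by
    rw [← pow_succ, Nat.sub_add_cancel (by omega)]
  rw [← Nat.cast_inj (R := ℂ)]
  push_cast [Nat.cast_sub hpp.one_le]
  constructor
  · intro h4
    linear_combination (p : ℂ) * h3 - h2 - (p : ℂ) * h4 + ((p : ℂ) - 1) * (e1 + e2)
  · intro h4
    refine mul_left_cancel₀ hp0 ?_
    linear_combination (p : ℂ) * h3 - h2 - h4 + ((p : ℂ) - 1) * (e1 + e2)

open scoped Classical in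
theorem card_filter_card_suppw (hp : p ≠ 2) {s l d : ℕ} (hs : s ≠ 0)
    (hF : Fintype.card F = p ^ (2 * s))
    (hd : s.gcd l = d) (hd' : (s + l).gcd (2 * l) = d) (hodd : Odd d) {a : F}
    (ha : a ^ p ^ s = a) (b c : F) :
    (univ.filter fun h => (suppw p s l a b c h).card
        = (p - 1) * (p ^ (2 * s - 1) + p ^ (s - 1))).card
      = if (radical p s l a b).card = 1 ∧ expSum p s l 1 a b = -(p : ℂ) ^ s then 1 else 0 := by
  simp only [card_suppw_eq_iff hp hs l hF ha]
  by_cases hab : a = 0 ∧ b = 0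
  · obtain ⟨rfl, rfl⟩ := hab
    rw [if_neg, card_eq_zero, filter_eq_empty_iff]
    · exact fun h _ => sum_affineExpSum_zero_ne hs l hF c h
    · rw [card_radical_zero hF]
      exact fun h =>
        (Nat.one_lt_pow (by omega) (Fact.out : p.Prime).one_lt).ne' h.1
  · rcases sum_affineExpSum_eq_iff hp hF hd hd' hodd ha hab c with ⟨h1, h2⟩ | ⟨h1, κ, h2⟩
    · rw [if_neg h1, card_eq_zero, filter_eq_empty_iff]
      exact fun h _ => h2 h
    · rw [if_pos h1, card_eq_one]
      refine ⟨κ, ext fun h => ?_⟩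
      rw [mem_filter, mem_singleton]
      exact (and_iff_right (mem_univ h)).trans (h2 h)

open scoped Classical in
theorem card_filter_quadruples (hp : p ≠ 2) {s l d : ℕ} (hs : s ≠ 0)
    (hF : Fintype.card F = p ^ (2 * s))
    (hd : s.gcd l = d) (hd' : (s + l).gcd (2 * l) = d) (hodd : Odd d) :
    ((univ : Finset (F × F × F × ZMod p)).filter fun t =>
        t.1 ^ p ^ s = t.1 ∧ (suppw p s l t.1 t.2.1 t.2.2.1 t.2.2.2).card
          = (p - 1) * (p ^ (2 * s - 1) + p ^ (s - 1))).card
      = p ^ (2 * s) * ∑ a ∈ fixedFinset p s F, ∑ b : F,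
        (if (radical p s l a b).card = 1 ∧ expSum p s l 1 a b = -(p : ℂ) ^ s then 1 else 0) := by
  rw [card_filter, Fintype.sum_prod_type, fixedFinset, mul_sum, sum_filter]
  refine sum_congr rfl fun a _ => ?_
  split_ifs with ha
  · rw [Fintype.sum_prod_type, mul_sum]
    refine sum_congr rfl fun b _ => ?_
    rw [Fintype.sum_prod_type]
    simp only [ha, true_and]
    refine (sum_congr rfl fun c _ => (card_filter _ _).symm.trans
      (card_filter_card_suppw hp hs hF hd hd' hodd ha b c)).trans ?_
    rw [sum_const, card_univ, hF, smul_eq_mul]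
  · simp [ha]

end Codewords

theorem stmt5 (p s l : ℕ) [Fact p.Prime] (F : Type) [Field F] [Fintype F] [DecidableEq F]
    [CharP F p] (hodd : Odd p) (hs : 2 ≤ s) (hl1 : 1 ≤ l) (hls : l ≠ s)
    (hl2 : l ≤ 2 * s - 1) (hF : Fintype.card F = p ^ (2 * s)) (d : ℕ)
    (hd : Nat.gcd s l = d) (hd' : Nat.gcd (s + l) (2 * l) = d) (hdodd : Odd d) :
    (((Finset.univ : Finset (F × F × F × ZMod p)).filter fun t =>
        t.1 ^ p ^ s = t.1 ∧ (suppw p s l t.1 t.2.1 t.2.2.1 t.2.2.2).card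
          = (p - 1) * (p ^ (2 * s - 1) + p ^ (s - 1))).card : ℚ)
      = (p : ℚ) ^ (2 * s + d) * ((p : ℚ) ^ (2 * s) - 2 * (p : ℚ) ^ (2 * s - d) + 1) * ((p : ℚ) ^ s - 1)
          / (2 * ((p : ℚ) ^ d - 1)) := by
  have hpp := (Fact.out : p.Prime)
  have hp : p ≠ 2 := by
    rintro rfl
    exact absurd hodd (by decide)
  have hs0 : s ≠ 0 := by omega
  let _ : Algebra (ZMod p) F := ZMod.algebra F p
  classical
  have h1 := sum_indicator_expSum (F := F) hp hs0 (by omega : l ≤ 2 * s) hF hd hd' hdodd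
  have hds : d ≤ 2 * s :=
    (Nat.le_of_dvd (by omega) (hd ▸ Nat.gcd_dvd_left s l : d ∣ s)).trans (by omega)
  rw [card_filter_quadruples hp hs0 hF hd hd' hdodd]
  set N : ℕ := ∑ a ∈ fixedFinset p s F, ∑ b : F,
    (if (radical p s l a b).card = 1 ∧ expSum p s l 1 a b = -(p : ℂ) ^ s then 1 else 0) with hN
  have h2 : 2 * ((p : ℂ) ^ d - 1) * (N : ℂ)
      = ((p : ℂ) ^ d * (p : ℂ) ^ (2 * s) - 2 * (p : ℂ) ^ (2 * s) + (p : ℂ) ^ d)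
        * ((p : ℂ) ^ s - 1) := by
    rw [← h1, hN]
    push_cast
    rfl
  have h3 : 2 * ((p : ℚ) ^ d - 1) * (N : ℚ)
      = ((p : ℚ) ^ d * (p : ℚ) ^ (2 * s) - 2 * (p : ℚ) ^ (2 * s) + (p : ℚ) ^ d)
        * ((p : ℚ) ^ s - 1) := by exact_mod_cast h2
  have hD : (p : ℚ) ^ d - 1 ≠ 0 := by
    refine sub_ne_zero.mpr ?_
    exact_mod_cast (Nat.one_lt_pow hdodd.pos.ne' hpp.one_lt).ne'
  have h4 : (p : ℚ) ^ (2 * s) = (p : ℚ) ^ (2 * s - d) * (p : ℚ) ^ d := by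
    rw [← pow_add, Nat.sub_add_cancel hds]
  rw [eq_div_iff (mul_ne_zero two_ne_zero hD)]
  push_cast
  rw [pow_add]
  linear_combination (p : ℚ) ^ (2 * s) * h3
    - 2 * (p : ℚ) ^ (2 * s) * ((p : ℚ) ^ s - 1) * h4
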